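/- Let R be a two-sided noetherian ring. If the class of Gorenstein injective left R-modules is closed under direct limits, then the class of Gorenstein injective complexes is covering in Ch(R): every unbounded chain complex of left R-modules has a Gorenstein injective cover. -/

import Mathlib

open CategoryTheory CategoryTheory.Limits

universe u

section GenericDefs

variable {𝒜 : Type*} [Category 𝒜] [Abelian 𝒜]

/-- An object `G` of an abelian category is *Gorenstein injective* if it is a cycle object of
an exact (ℤ-indexed) complex of injective objects which stays exact under `Hom(I, -)` for
every injective object `I`. -/
def IsGorensteinInjective (G : 𝒜) : Prop :=
  ∃ C : ChainComplex 𝒜 ℤ,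
    (∀ n, Injective (C.X n)) ∧
    (∀ n, C.ExactAt n) ∧
    (∀ (I : 𝒜), Injective I → ∀ n,
      (((preadditiveCoyoneda.obj (Opposite.op I)).mapHomologicalComplex _).obj C).ExactAt n) ∧
    Nonempty (G ≅ kernel (C.d 0 (-1)))

/-- An object `G` is *Gorenstein projective* if it is a cycle object of an exact complex of
projectives which stays exact under `Hom(-, P)` for every projective `P`. -/
def IsGorensteinProjective (G : 𝒜) : Prop :=
  ∃ C : ChainComplex 𝒜 ℤ,
    (∀ n, Projective (C.X n)) ∧
    (∀ n, C.ExactAt n) ∧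
    (∀ (P : 𝒜), Projective P → ∀ n,
      (((preadditiveYoneda.obj P).mapHomologicalComplex _).obj C.op).ExactAt n) ∧
    Nonempty (G ≅ kernel (C.d 0 (-1)))

/-- `φ : G ⟶ X` is a `𝒞`-precover of `X`. -/
def IsPrecover (𝒞 : 𝒜 → Prop) {G X : 𝒜} (φ : G ⟶ X) : Prop :=
  𝒞 G ∧ ∀ (G' : 𝒜), 𝒞 G' → ∀ ψ : G' ⟶ X, ∃ h : G' ⟶ G, h ≫ φ = ψ

/-- `φ : G ⟶ X` is a `𝒞`-cover of `X`. -/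
def IsCover (𝒞 : 𝒜 → Prop) {G X : 𝒜} (φ : G ⟶ X) : Prop :=
  IsPrecover 𝒞 φ ∧ ∀ f : G ⟶ G, f ≫ φ = φ → IsIso f

/-- `φ : X ⟶ G` is a `𝒞`-preenvelope of `X`. -/
def IsPreenvelope (𝒞 : 𝒜 → Prop) {X G : 𝒜} (φ : X ⟶ G) : Prop :=
  𝒞 G ∧ ∀ (G' : 𝒜), 𝒞 G' → ∀ ψ : X ⟶ G', ∃ h : G ⟶ G', φ ≫ h = ψ

/-- `φ : X ⟶ G` is a `𝒞`-envelope of `X`. -/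
def IsEnvelope (𝒞 : 𝒜 → Prop) {X G : 𝒜} (φ : X ⟶ G) : Prop :=
  IsPreenvelope 𝒞 φ ∧ ∀ f : G ⟶ G, φ ≫ f = φ → IsIso f

/-- `Ext¹(X, Y) = 0`, expressed by the splitting of every extension of `X` by `Y`. -/
def Ext1Zero (X Y : 𝒜) : Prop :=
  ∀ (E : 𝒜) (i : Y ⟶ E) (p : E ⟶ X) (w : i ≫ p = 0),
    (ShortComplex.mk i p w).ShortExact → ∃ s : X ⟶ E, s ≫ p = 𝟙 X

/-- `ExtSucZero n X Y` says `Ext^(n+1)(X, Y) = 0`; defined by dimension shifting along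
short exact sequences `0 ⟶ Y ⟶ E ⟶ Y' ⟶ 0` with `E` injective. -/
def ExtSucZero : ℕ → 𝒜 → 𝒜 → Prop
  | 0, X, Y => Ext1Zero X Y
  | (n+1), X, Y => ∀ (E Y' : 𝒜) (i : Y ⟶ E) (p : E ⟶ Y') (w : i ≫ p = 0),
      (ShortComplex.mk i p w).ShortExact → Injective E → ExtSucZero n X Y'

/-- A special `𝒞`-precover: an epimorphism `φ : G ⟶ X` with `G ∈ 𝒞` arising in a short exact
sequence `0 ⟶ A ⟶ G ⟶ X ⟶ 0` with `Ext¹(G', A) = 0` for all `G' ∈ 𝒞`. -/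
def IsSpecialPrecover (𝒞 : 𝒜 → Prop) {G X : 𝒜} (φ : G ⟶ X) : Prop :=
  IsPrecover 𝒞 φ ∧ ∃ (A : 𝒜) (i : A ⟶ G) (w : i ≫ φ = 0),
    (ShortComplex.mk i φ w).ShortExact ∧ ∀ (G' : 𝒜), 𝒞 G' → Ext1Zero G' A

/-- The left `Ext¹`-orthogonal class `⊥𝒞` of a class of objects `𝒞`. -/
def leftOrthogonal {𝒜 : Type*} [Category 𝒜] [Abelian 𝒜] (𝒞 : 𝒜 → Prop) (X : 𝒜) : Prop :=
  ∀ Y : 𝒜, 𝒞 Y → Ext1Zero X Y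

/-- The right `Ext¹`-orthogonal class `𝒞⊥` of a class of objects `𝒞`. -/
def rightOrthogonal {𝒜 : Type*} [Category 𝒜] [Abelian 𝒜] (𝒞 : 𝒜 → Prop) (Y : 𝒜) : Prop :=
  ∀ X : 𝒜, 𝒞 X → Ext1Zero X Y

end GenericDefs

section Steps

variable {𝒜 : Type*} [Category 𝒜] [Abelian 𝒜]

/-- There is a short exact sequence `0 ⟶ A ⟶ E ⟶ B ⟶ 0` with `E` injective, along which maps
from injective objects lift. -/
def InjStep (A B : 𝒜) : Prop :=
  ∃ (E : 𝒜) (i : A ⟶ E) (p : E ⟶ B) (w : i ≫ p = 0),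
    (ShortComplex.mk i p w).ShortExact ∧ Injective E ∧
      ∀ (I : 𝒜), Injective I → ∀ f : I ⟶ B, ∃ f' : I ⟶ E, f' ≫ p = f

lemma exactAt_down_iff {𝒞 : Type*} [Category 𝒞] [Abelian 𝒞] (C : ChainComplex 𝒞 ℤ) {i j k : ℤ}
    (hi : j + 1 = i) (hk : k + 1 = j) :
    C.ExactAt j ↔ (ShortComplex.mk (C.d i j) (C.d j k) (C.d_comp_d i j k)).Exact :=
  C.exactAt_iff' i j k (by simp; omega) (by simp; omega)

lemma coyoneda_exactAt_iff (C : ChainComplex 𝒜 ℤ) (I : 𝒜) {i j k : ℤ}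
    (hi : j + 1 = i) (hk : k + 1 = j) :
    (((preadditiveCoyoneda.obj (Opposite.op I)).mapHomologicalComplex _).obj C).ExactAt j ↔
      ∀ φ : I ⟶ C.X j, φ ≫ C.d j k = 0 → ∃ χ : I ⟶ C.X i, χ ≫ C.d i j = φ := by
  rw [exactAt_down_iff _ hi hk, ShortComplex.ab_exact_iff]
  rfl

lemma CategoryTheory.ShortComplex.ShortExact.exists_lift {S : ShortComplex 𝒜} (hS : S.ShortExact) {A : 𝒜}
    (k : A ⟶ S.X₂) (hk : k ≫ S.g = 0) : ∃ l : A ⟶ S.X₁, l ≫ S.f = k := by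
  have := hS.mono_f
  exact ⟨hS.exact.lift k hk, hS.exact.lift_f k hk⟩

lemma isGorensteinInjective_of_injSteps {G : 𝒜} (Z : ℤ → 𝒜) (e : G ≅ Z 0)
    (hZ : ∀ i j, j + 1 = i → InjStep (Z i) (Z j)) : IsGorensteinInjective G := by
  choose E ι p w hse hE hl using fun i : ℤ ↦ hZ i (i - 1) (by simp)
  have key : ∀ i j, j + 1 = i → ∃ (π : E i ⟶ Z j) (w : ι i ≫ π = 0),
      (ShortComplex.mk (ι i) π w).ShortExact ∧
      ∀ (I : 𝒜), Injective I → ∀ f : I ⟶ Z j, ∃ f' : I ⟶ E i, f' ≫ π = f := by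
    intro i j h
    obtain rfl : j = i - 1 := by omega
    exact ⟨p i, w i, hse i, hl i⟩
  choose π w' hse' hl' using key
  let C : ChainComplex 𝒜 ℤ :=
    { X := E
      d := fun i j ↦ if h : j + 1 = i then π i j h ≫ ι j else 0
      shape := fun i j h ↦ dif_neg h
      d_comp_d' := by
        rintro i j k (rfl : _ = _) (rfl : _ = _)
        simp [reassoc_of% (w' (k + 1) k rfl)] }
  have hd : ∀ i j (h : j + 1 = i), C.d i j = π i j h ≫ ι j := fun i j h ↦ dif_pos h
  refine ⟨C, hE, fun n ↦ ?_, fun I hI n ↦ ?_, ?_⟩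
  · rw [exactAt_down_iff C (i := n + 1) (k := n - 1) (by omega) (by omega)]
    rw [ShortComplex.exact_iff_exact_up_to_refinements]
    intro A (x : A ⟶ C.X n) (hx : x ≫ C.d n (n - 1) = 0)
    have hm := (hse' (n - 1) (n - 1 - 1) (by omega)).mono_f
    rw [hd n (n - 1) (by omega), ← Category.assoc] at hx
    have hx' : x ≫ π n (n - 1) (by omega) = 0 := by
      rw [← cancel_mono (ι (n - 1)), hx, zero_comp]
    obtain ⟨l, hl⟩ := ShortComplex.ShortExact.exists_lift (hse' n (n - 1) (by omega)) x hx'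
    have he := (hse' (n + 1) n rfl).epi_g
    dsimp at he hl
    refine ⟨pullback l (π (n + 1) n rfl), pullback.fst _ _, inferInstance,
      pullback.snd _ _, ?_⟩
    dsimp
    rw [hd (n + 1) n rfl, ← Category.assoc, ← pullback.condition, Category.assoc, hl]
  · rw [coyoneda_exactAt_iff C I (i := n + 1) (k := n - 1) (by omega) (by omega)]
    intro φ hφ
    have hm := (hse' (n - 1) (n - 1 - 1) (by omega)).mono_f
    rw [hd n (n - 1) (by omega), ← Category.assoc] at hφ
    have hx' : φ ≫ π n (n - 1) (by omega) = 0 := by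
      rw [← cancel_mono (ι (n - 1)), hφ, zero_comp]
    obtain ⟨l, hl⟩ := ShortComplex.ShortExact.exists_lift (hse' n (n - 1) (by omega)) φ hx'
    obtain ⟨χ, hχ⟩ := hl' (n + 1) n rfl I hI l
    refine ⟨χ, ?_⟩
    rw [hd (n + 1) n rfl, reassoc_of% hχ]
    exact hl
  · have hm := (hse' (-1) (-2) (by omega)).mono_f
    have hm0 := (hse' 0 (-1) (by omega)).mono_f
    dsimp at hm hm0
    have z : ι 0 ≫ C.d 0 (-1) = 0 := by
      rw [hd 0 (-1) (by omega), reassoc_of% (w' 0 (-1) (by omega)), zero_comp]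
    have hker : IsLimit (KernelFork.ofι (ι 0) z) := by
      refine KernelFork.IsLimit.ofι' _ _ fun {A} k hk ↦ ?_
      refine ⟨(hse' 0 (-1) (by omega)).exact.lift k ?_, (hse' 0 (-1) (by omega)).exact.lift_f k _⟩
      rw [hd 0 (-1) (by omega), ← Category.assoc] at hk
      rw [← cancel_mono (ι (-1))]
      simpa using hk
    exact ⟨e ≪≫ hker.conePointUniqueUpToIso (limit.isLimit _)⟩

lemma injStep_kernel (C : ChainComplex 𝒜 ℤ) {i j k : ℤ} (hi : j + 1 = i) (hk : k + 1 = j)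
    (hE : Injective (C.X i)) (hex : C.ExactAt j)
    (hhom : ∀ (I : 𝒜), Injective I →
      (((preadditiveCoyoneda.obj (Opposite.op I)).mapHomologicalComplex _).obj C).ExactAt j) :
    InjStep (kernel (C.d i j)) (kernel (C.d j k)) := by
  have hz : C.d i j ≫ C.d j k = 0 := C.d_comp_d _ _ _
  have e1 := (exactAt_down_iff C hi hk).1 hex
  have hepi : Epi (kernel.lift _ _ hz) := (ShortComplex.exact_iff_epi_kernel_lift _).1 e1
  have w : kernel.ι (C.d i j) ≫ kernel.lift _ _ hz = 0 := by
    rw [← cancel_mono (kernel.ι _)]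
    simp
  refine ⟨C.X i, kernel.ι _, kernel.lift _ _ hz, w, ?_, hE, ?_⟩
  · refine { exact := ?_, mono_f := inferInstanceAs (Mono (kernel.ι _)), epi_g := hepi }
    apply ShortComplex.exact_of_f_is_kernel
    refine KernelFork.IsLimit.ofι' _ _ fun {A} (l : A ⟶ C.X i)
      (hl : l ≫ kernel.lift _ _ hz = 0) ↦ ?_
    have h3 : l ≫ C.d i j = 0 := by simpa using hl =≫ kernel.ι _
    exact ⟨kernel.lift _ l h3, kernel.lift_ι _ _ _⟩
  · intro I hI f
    obtain ⟨χ, hχ⟩ := (coyoneda_exactAt_iff C I hi hk).1 (hhom I hI) (f ≫ kernel.ι _) (by simp)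
    refine ⟨χ, ?_⟩
    rw [← cancel_mono (kernel.ι _)]
    simpa using hχ

lemma IsGorensteinInjective.exists_injSteps {G : 𝒜} (hG : IsGorensteinInjective G) :
    ∃ Z : ℤ → 𝒜, Nonempty (G ≅ Z 0) ∧ ∀ i j, j + 1 = i → InjStep (Z i) (Z j) := by
  obtain ⟨C, hE, hex, hhom, ⟨e⟩⟩ := hG
  refine ⟨fun n ↦ kernel (C.d n (n - 1)), ⟨e ≪≫ eqToIso (by simp)⟩, ?_⟩
  intro i j h
  obtain rfl : j = i - 1 := by omega
  exact injStep_kernel C h (by omega) (hE _) (hex _) (fun I hI ↦ hhom I hI _)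

lemma IsGorensteinInjective.of_iso {G G' : 𝒜} (hG : IsGorensteinInjective G) (e : G ≅ G') :
    IsGorensteinInjective G' := by
  obtain ⟨C, hE, hex, hhom, ⟨f⟩⟩ := hG
  exact ⟨C, hE, hex, hhom, ⟨e.symm ≪≫ f⟩⟩

lemma IsGorensteinInjective.exists_injStep_left {G : 𝒜} (hG : IsGorensteinInjective G) :
    ∃ A, IsGorensteinInjective A ∧ InjStep A G := by
  obtain ⟨Z, ⟨e⟩, hZ⟩ := hG.exists_injSteps
  refine ⟨Z 1, isGorensteinInjective_of_injSteps (fun n ↦ Z (n + 1)) (Iso.refl _)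
    (fun i j h ↦ hZ _ _ (by omega)), ?_⟩
  obtain ⟨E, i, p, w, hse, hE, hl⟩ := hZ 1 0 (by omega)
  refine ⟨E, i, p ≫ e.inv, by simp [reassoc_of% w], ?_, hE, fun I hI f ↦ ?_⟩
  · have φ : ShortComplex.mk i p w ≅ ShortComplex.mk i (p ≫ e.inv) (by simp [reassoc_of% w]) :=
      ShortComplex.isoMk (Iso.refl _) (Iso.refl _) e.symm (by simp) (by simp)
    exact ShortComplex.shortExact_of_iso φ hse
  · obtain ⟨f', hf'⟩ := hl I hI (f ≫ e.hom)
    exact ⟨f', by simp [reassoc_of% hf']⟩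

lemma IsGorensteinInjective.exists_injStep_right {G : 𝒜} (hG : IsGorensteinInjective G) :
    ∃ B, IsGorensteinInjective B ∧ InjStep G B := by
  obtain ⟨Z, ⟨e⟩, hZ⟩ := hG.exists_injSteps
  refine ⟨Z (-1), isGorensteinInjective_of_injSteps (fun n ↦ Z (n - 1)) (Iso.refl _)
    (fun i j h ↦ hZ _ _ (by omega)), ?_⟩
  obtain ⟨E, i, p, w, hse, hE, hl⟩ := hZ 0 (-1) (by omega)
  refine ⟨E, e.hom ≫ i, p, by simp [w], ?_, hE, hl⟩
  have φ : ShortComplex.mk i p w ≅ ShortComplex.mk (e.hom ≫ i) p (by simp [w]) :=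
    ShortComplex.isoMk e.symm (Iso.refl _) (Iso.refl _) (by simp) (by simp)
  exact ShortComplex.shortExact_of_iso φ hse

/-- Gorenstein injectivity by coinduction: it suffices to find a class of objects in which every
member has a left and a right step within the class. -/
lemma isGorensteinInjective_of_class (P : 𝒜 → Prop)
    (hleft : ∀ G, P G → ∃ A, P A ∧ InjStep A G) (hright : ∀ G, P G → ∃ B, P B ∧ InjStep G B)
    {G : 𝒜} (hG : P G) : IsGorensteinInjective G := by
  choose L hL hLs using hleft
  choose M hM hMs using hright
  let l : ℕ → {X // P X} := fun n ↦ Nat.rec ⟨G, hG⟩ (fun _ X ↦ ⟨L X.1 X.2, hL _ _⟩) n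
  let r : ℕ → {X // P X} := fun n ↦ Nat.rec ⟨G, hG⟩ (fun _ X ↦ ⟨M X.1 X.2, hM _ _⟩) n
  let Z : ℤ → 𝒜 := fun n ↦ match n with
    | Int.ofNat k => (l k).1
    | Int.negSucc k => (r (k + 1)).1
  refine isGorensteinInjective_of_injSteps Z (Iso.refl _) ?_
  rintro i j rfl
  match j with
  | Int.ofNat k => exact hLs (l k).1 (l k).2
  | Int.negSucc 0 => exact hMs (r 0).1 (r 0).2
  | Int.negSucc (k + 1) => exact hMs (r (k + 1)).1 (r (k + 1)).2

end Steps

section Extensions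

open ZeroObject

variable {𝒜 : Type*} [Category 𝒜] [Abelian 𝒜]

lemma exists_shortExact_of_kernels {S₁ S₂ : ShortComplex 𝒜} (ψ : S₁ ⟶ S₂)
    (h₁ : S₁.ShortExact) (h₂ : S₂.ShortExact) {K₁ K₂ K₃ : 𝒜}
    {k₁ : K₁ ⟶ S₁.X₁} {k₂ : K₂ ⟶ S₁.X₂} {k₃ : K₃ ⟶ S₁.X₃}
    {w₁ : k₁ ≫ ψ.τ₁ = 0} {w₂ : k₂ ≫ ψ.τ₂ = 0} {w₃ : k₃ ≫ ψ.τ₃ = 0}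
    (c₁ : (ShortComplex.mk k₁ ψ.τ₁ w₁).ShortExact) (c₂ : (ShortComplex.mk k₂ ψ.τ₂ w₂).ShortExact)
    (c₃ : (ShortComplex.mk k₃ ψ.τ₃ w₃).ShortExact) :
    ∃ (f : K₁ ⟶ K₂) (g : K₂ ⟶ K₃) (w : f ≫ g = 0), (ShortComplex.mk f g w).ShortExact ∧
      f ≫ k₂ = k₁ ≫ S₁.f ∧ g ≫ k₃ = k₂ ≫ S₁.g := by
  obtain ⟨f, hf⟩ := ShortComplex.ShortExact.exists_lift c₂ (k₁ ≫ S₁.f)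
    (by dsimp; rw [Category.assoc, ← ψ.comm₁₂, reassoc_of% w₁, zero_comp])
  obtain ⟨g, hg⟩ := ShortComplex.ShortExact.exists_lift c₃ (k₂ ≫ S₁.g)
    (by dsimp; rw [Category.assoc, ← ψ.comm₂₃, reassoc_of% w₂, zero_comp])
  dsimp at hf hg
  have m₁ : Mono k₁ := c₁.mono_f
  have m₂ : Mono k₂ := c₂.mono_f
  have m₃ : Mono k₃ := c₃.mono_f
  have m₁' : Mono S₁.f := h₁.mono_f
  have m₂' : Mono S₂.f := h₂.mono_f
  have e₁' : Epi S₁.g := h₁.epi_g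
  have e₁ : Epi ψ.τ₁ := c₁.epi_g
  have w : f ≫ g = 0 := by
    rw [← cancel_mono k₃, Category.assoc, hg, reassoc_of% hf, S₁.zero, comp_zero, zero_comp]
  refine ⟨f, g, w, { exact := ?_, mono_f := ?_, epi_g := ?_ }, hf, hg⟩
  · rw [ShortComplex.exact_iff_exact_up_to_refinements]
    intro A (x : A ⟶ K₂) (hx : x ≫ g = 0)
    obtain ⟨y, hy⟩ := ShortComplex.ShortExact.exists_lift h₁ (x ≫ k₂)
      (by rw [Category.assoc, ← hg, reassoc_of% hx, zero_comp])
    obtain ⟨z, hz⟩ := ShortComplex.ShortExact.exists_lift c₁ y (by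
      dsimp
      rw [← cancel_mono S₂.f, Category.assoc, ψ.comm₁₂, reassoc_of% hy, w₂, comp_zero, zero_comp])
    refine ⟨A, 𝟙 _, inferInstance, z, ?_⟩
    dsimp at hz ⊢
    rw [← cancel_mono k₂, Category.assoc, Category.assoc, Category.id_comp, hf, reassoc_of% hz, hy]
  · have : Mono (f ≫ k₂) := by rw [hf]; infer_instance
    exact mono_of_mono f k₂
  · change Epi g
    rw [epi_iff_surjective_up_to_refinements]
    intro A c
    obtain ⟨A', π, hπ, y, hy⟩ := surjective_up_to_refinements_of_epi S₁.g (c ≫ k₃)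
    obtain ⟨a, ha⟩ := ShortComplex.ShortExact.exists_lift h₂ (y ≫ ψ.τ₂) (by
      rw [Category.assoc, ψ.comm₂₃, ← reassoc_of% hy, w₃, comp_zero, comp_zero])
    obtain ⟨A'', π', hπ', z, hz⟩ := surjective_up_to_refinements_of_epi ψ.τ₁ a
    obtain ⟨t, ht⟩ := ShortComplex.ShortExact.exists_lift c₂ (π' ≫ y - z ≫ S₁.f) (by
      dsimp
      rw [Preadditive.sub_comp, Category.assoc, Category.assoc, ← ψ.comm₁₂, ← ha,
        reassoc_of% hz, sub_self])
    refine ⟨A'', π' ≫ π, inferInstance, t, ?_⟩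
    dsimp at ht
    rw [← cancel_mono k₃, Category.assoc, Category.assoc, Category.assoc, hg, reassoc_of% ht,
      Preadditive.sub_comp, Category.assoc, Category.assoc, S₁.zero, comp_zero, sub_zero, hy]

lemma exists_shortExact_of_cokernels {S₁ S₂ : ShortComplex 𝒜} (ψ : S₁ ⟶ S₂)
    (h₁ : S₁.ShortExact) (h₂ : S₂.ShortExact) {Q₁ Q₂ Q₃ : 𝒜}
    {q₁ : S₂.X₁ ⟶ Q₁} {q₂ : S₂.X₂ ⟶ Q₂} {q₃ : S₂.X₃ ⟶ Q₃}
    {w₁ : ψ.τ₁ ≫ q₁ = 0} {w₂ : ψ.τ₂ ≫ q₂ = 0} {w₃ : ψ.τ₃ ≫ q₃ = 0}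
    (c₁ : (ShortComplex.mk ψ.τ₁ q₁ w₁).ShortExact) (c₂ : (ShortComplex.mk ψ.τ₂ q₂ w₂).ShortExact)
    (c₃ : (ShortComplex.mk ψ.τ₃ q₃ w₃).ShortExact) :
    ∃ (f : Q₁ ⟶ Q₂) (g : Q₂ ⟶ Q₃) (w : f ≫ g = 0), (ShortComplex.mk f g w).ShortExact ∧
      q₁ ≫ f = S₂.f ≫ q₂ ∧ q₂ ≫ g = S₂.g ≫ q₃ := by
  have d₁ : (ShortComplex.mk q₃.op ψ.τ₃.op (by rw [← op_comp, w₃, op_zero])).ShortExact := c₃.op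
  have d₂ : (ShortComplex.mk q₂.op ψ.τ₂.op (by rw [← op_comp, w₂, op_zero])).ShortExact := c₂.op
  have d₃ : (ShortComplex.mk q₁.op ψ.τ₁.op (by rw [← op_comp, w₁, op_zero])).ShortExact := c₁.op
  obtain ⟨f, g, w, h, hf, hg⟩ := exists_shortExact_of_kernels (ShortComplex.opMap ψ) h₂.op h₁.op d₁ d₂ d₃
  exact ⟨g.unop, f.unop, by rw [← unop_comp, w, unop_zero], h.unop,
    congrArg Quiver.Hom.unop hg, congrArg Quiver.Hom.unop hf⟩

lemma InjStep.exists_lift_of_shortExact {A B' : 𝒜} (h : InjStep A B') {B C : 𝒜} {i : A ⟶ B}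
    {g : B ⟶ C} {w : i ≫ g = 0} (hs : (ShortComplex.mk i g w).ShortExact) {I : 𝒜}
    (hI : Injective I) (f : I ⟶ C) : ∃ l : I ⟶ B, l ≫ g = f := by
  obtain ⟨E, j, p, w', hs', hE, hl⟩ := h
  have mi : Mono i := hs.mono_f
  have mj : Mono j := hs'.mono_f
  have eg : Epi g := hs.epi_g
  let u : B ⟶ E := Injective.factorThru j i
  have hu : i ≫ u = j := Injective.comp_factorThru j i
  obtain ⟨v, hv⟩ : ∃ v : C ⟶ B', g ≫ v = u ≫ p :=
    ⟨hs.exact.desc (u ≫ p) (by dsimp; rw [reassoc_of% hu, w']), hs.exact.g_desc _ _⟩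
  obtain ⟨t, ht⟩ := hl I hI (f ≫ v)
  have ex : (ShortComplex.mk (biprod.lift u g) (biprod.desc p (-v)) (by simp [hv])).Exact := by
    rw [ShortComplex.exact_iff_exact_up_to_refinements]
    intro T (x : T ⟶ E ⊞ C) (hx : x ≫ biprod.desc p (-v) = 0)
    have hx' : (x ≫ biprod.fst) ≫ p = (x ≫ biprod.snd) ≫ v := by
      rw [biprod.desc_eq] at hx
      simpa [← sub_eq_add_neg, sub_eq_zero] using hx
    obtain ⟨T', π, hπ, b, hb⟩ := surjective_up_to_refinements_of_epi g (x ≫ biprod.snd)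
    obtain ⟨a, ha⟩ := ShortComplex.ShortExact.exists_lift hs' (π ≫ x ≫ biprod.fst - b ≫ u) (by
      dsimp
      rw [Preadditive.sub_comp, Category.assoc, hx', Category.assoc b, ← hv, ← reassoc_of% hb,
        Category.assoc, sub_self])
    refine ⟨T', π, hπ, b + a ≫ i, ?_⟩
    dsimp at ha ⊢
    ext
    · simp [hu, ha]
    · simp [w, ← hb]
  have mm : Mono (biprod.lift u g) := by
    rw [Preadditive.mono_iff_cancel_zero]
    intro T x hx
    have h1 : x ≫ u = 0 := by simpa using hx =≫ biprod.fst
    have h2 : x ≫ g = 0 := by simpa using hx =≫ biprod.snd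
    obtain ⟨a, ha⟩ := ShortComplex.ShortExact.exists_lift hs x h2
    dsimp at ha
    rw [← ha, Category.assoc, hu] at h1
    rw [← ha, zero_of_comp_mono j h1, zero_comp]
  refine ⟨ex.lift (biprod.lift t f) (by simp [ht]), ?_⟩
  have h3 : _ ≫ biprod.lift u g = _ := ex.lift_f (biprod.lift t f) (by simp [ht])
  simpa using h3 =≫ biprod.snd

lemma shortExact_biprod (X Y : 𝒜) :
    (ShortComplex.mk (biprod.inl : X ⟶ X ⊞ Y) (biprod.snd : X ⊞ Y ⟶ Y) (by simp)).ShortExact :=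
  (ShortComplex.Splitting.ofHasBinaryBiproduct X Y).shortExact

lemma shortExact_id_zero (X : 𝒜) :
    (ShortComplex.mk (𝟙 X) (0 : X ⟶ 0) (by simp)).ShortExact :=
  (ShortComplex.Splitting.mk (S := ShortComplex.mk (𝟙 X) (0 : X ⟶ 0) (by simp)) (𝟙 X) 0
    (by simp) (by exact (isZero_zero 𝒜).eq_of_tgt _ _) (by simp)).shortExact

lemma shortExact_zero_id (X : 𝒜) :
    (ShortComplex.mk (0 : 0 ⟶ X) (𝟙 X) (by simp)).ShortExact :=
  (ShortComplex.Splitting.mk (S := ShortComplex.mk (0 : 0 ⟶ X) (𝟙 X) (by simp)) 0 (𝟙 X)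
    (by exact (isZero_zero 𝒜).eq_of_tgt _ _) (by simp) (by simp)).shortExact

/-- The step obtained by taking the direct sum of two short exact sequences of injective steps. -/
lemma InjStep.exists_left_of_shortExact {A B C A' C' : 𝒜} (hA : InjStep A' A) (hC : InjStep C' C)
    {A'' : 𝒜} (hA' : InjStep A A'') {i : A ⟶ B} {g : B ⟶ C} {w : i ≫ g = 0}
    (hs : (ShortComplex.mk i g w).ShortExact) :
    ∃ (B' : 𝒜) (i' : A' ⟶ B') (g' : B' ⟶ C') (w' : i' ≫ g' = 0),
      (ShortComplex.mk i' g' w').ShortExact ∧ InjStep B' B := by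
  obtain ⟨E, j, p, wp, hp, hE, hlp⟩ := hA
  obtain ⟨F, k, q, wq, hq, hF, hlq⟩ := hC
  obtain ⟨l, hl⟩ := hA'.exists_lift_of_shortExact hs hF q
  let ψ : ShortComplex.mk (biprod.inl : E ⟶ E ⊞ F) (biprod.snd : E ⊞ F ⟶ F) (by simp) ⟶
      ShortComplex.mk i g w :=
    { τ₁ := p
      τ₂ := biprod.desc (p ≫ i) l
      τ₃ := q
      comm₁₂ := by simp
      comm₂₃ := by ext <;> simp [w, hl] }
  have e₁ : Epi p := hp.epi_g
  have e₃ : Epi q := hq.epi_g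
  have eg : Epi (ShortComplex.mk i g w).g := hs.epi_g
  have e₁' : Epi ψ.τ₁ := e₁
  have e₃' : Epi ψ.τ₃ := e₃
  have eψ : Epi ψ.τ₂ := ShortComplex.epi_τ₂_of_exact_of_epi ψ hs.exact
  have c₂ : (ShortComplex.mk (kernel.ι ψ.τ₂) ψ.τ₂ (kernel.condition _)).ShortExact :=
    { exact := ShortComplex.exact_of_f_is_kernel _ (kernelIsKernel _)
      mono_f := inferInstanceAs (Mono (kernel.ι ψ.τ₂))
      epi_g := eψ }
  obtain ⟨f', g', w', hs', -, -⟩ :=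
    exists_shortExact_of_kernels ψ (shortExact_biprod E F) hs (w₁ := wp) (w₃ := wq) hp c₂ hq
  refine ⟨_, f', g', w', hs', E ⊞ F, kernel.ι ψ.τ₂, ψ.τ₂, _, c₂, inferInstance, fun I hI f ↦ ?_⟩
  obtain ⟨y, hy⟩ := hlq I hI (f ≫ g)
  obtain ⟨z, hz⟩ := ShortComplex.ShortExact.exists_lift hs (f - y ≫ l) (by simp [hl, hy])
  obtain ⟨x, hx⟩ := hlp I hI z
  refine ⟨biprod.lift x y, ?_⟩
  dsimp at hz
  simp [ψ, reassoc_of% hx, hz]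

lemma InjStep.exists_right_of_shortExact {A B C A' C' : 𝒜} (hA : InjStep A A') (hC : InjStep C C')
    {i : A ⟶ B} {g : B ⟶ C} {w : i ≫ g = 0} (hs : (ShortComplex.mk i g w).ShortExact) :
    ∃ (B' : 𝒜) (i' : A' ⟶ B') (g' : B' ⟶ C') (w' : i' ≫ g' = 0),
      (ShortComplex.mk i' g' w').ShortExact ∧ InjStep B B' := by
  obtain ⟨E, j, p, wp, hp, hE, hlp⟩ := hA
  obtain ⟨F, k, q, wq, hq, hF, hlq⟩ := hC
  have mi : Mono i := hs.mono_f
  let u : B ⟶ E := Injective.factorThru j i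
  have hu : i ≫ u = j := Injective.comp_factorThru j i
  let ψ : ShortComplex.mk i g w ⟶
      ShortComplex.mk (biprod.inl : E ⟶ E ⊞ F) (biprod.snd : E ⊞ F ⟶ F) (by simp) :=
    { τ₁ := j
      τ₂ := biprod.lift u (g ≫ k)
      τ₃ := k
      comm₁₂ := by ext <;> simp [hu, reassoc_of% w]
      comm₂₃ := by simp }
  have m₁ : Mono ψ.τ₁ := hp.mono_f
  have m₃ : Mono ψ.τ₃ := hq.mono_f
  have eψ : Mono ψ.τ₂ := ShortComplex.mono_τ₂_of_exact_of_mono ψ hs.exact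
  have c₂ : (ShortComplex.mk ψ.τ₂ (cokernel.π ψ.τ₂) (cokernel.condition _)).ShortExact :=
    { exact := ShortComplex.exact_of_g_is_cokernel _ (cokernelIsCokernel _)
      mono_f := eψ
      epi_g := inferInstanceAs (Epi (cokernel.π ψ.τ₂)) }
  obtain ⟨f', g', w', hs', hf', hg'⟩ :=
    exists_shortExact_of_cokernels ψ hs (shortExact_biprod E F) (w₁ := wp) (w₃ := wq) hp c₂ hq
  refine ⟨_, f', g', w', hs', E ⊞ F, ψ.τ₂, cokernel.π ψ.τ₂, _, c₂, inferInstance, fun I hI f ↦ ?_⟩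
  dsimp at hf' hg'
  obtain ⟨y, hy⟩ := hlq I hI (f ≫ g')
  obtain ⟨z, hz⟩ := ShortComplex.ShortExact.exists_lift hs'
    (f - (y ≫ biprod.inr) ≫ cokernel.π ψ.τ₂) (by simp [hg', hy])
  obtain ⟨x, hx⟩ := hlp I hI z
  refine ⟨x ≫ biprod.inl + y ≫ biprod.inr, ?_⟩
  dsimp at hz
  rw [Preadditive.add_comp, Category.assoc x, ← hf', reassoc_of% hx, hz]
  simp

lemma IsGorensteinInjective.exists_lift {A B C I : 𝒜} (hA : IsGorensteinInjective A) {i : A ⟶ B}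
    {g : B ⟶ C} {w : i ≫ g = 0} (hs : (ShortComplex.mk i g w).ShortExact)
    (hI : Injective I) (f : I ⟶ C) : ∃ l : I ⟶ B, l ≫ g = f := by
  obtain ⟨B', -, h⟩ := hA.exists_injStep_right
  exact h.exists_lift_of_shortExact hs hI f

/-- Gorenstein injective objects are closed under extensions. -/
lemma IsGorensteinInjective.of_shortExact {A B C : 𝒜} (hA : IsGorensteinInjective A)
    (hC : IsGorensteinInjective C) {i : A ⟶ B} {g : B ⟶ C} {w : i ≫ g = 0}
    (hs : (ShortComplex.mk i g w).ShortExact) : IsGorensteinInjective B := by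
  refine isGorensteinInjective_of_class
    (fun B ↦ ∃ (A C : 𝒜) (i : A ⟶ B) (g : B ⟶ C) (w : i ≫ g = 0),
      IsGorensteinInjective A ∧ IsGorensteinInjective C ∧ (ShortComplex.mk i g w).ShortExact)
    ?_ ?_ ⟨A, C, i, g, w, hA, hC, hs⟩
  · rintro B ⟨A, C, i, g, w, hA, hC, hs⟩
    obtain ⟨A', hA', sA⟩ := hA.exists_injStep_left
    obtain ⟨C', hC', sC⟩ := hC.exists_injStep_left
    obtain ⟨A'', hA'', sA'⟩ := hA.exists_injStep_right
    obtain ⟨B', i', g', w', hs', hB⟩ := sA.exists_left_of_shortExact sC sA' hs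
    exact ⟨B', ⟨A', C', i', g', w', hA', hC', hs'⟩, hB⟩
  · rintro B ⟨A, C, i, g, w, hA, hC, hs⟩
    obtain ⟨A', hA', sA⟩ := hA.exists_injStep_right
    obtain ⟨C', hC', sC⟩ := hC.exists_injStep_right
    obtain ⟨B', i', g', w', hs', hB⟩ := sA.exists_right_of_shortExact sC hs
    exact ⟨B', ⟨A', C', i', g', w', hA', hC', hs'⟩, hB⟩

lemma isGorensteinInjective_of_isZero {G : 𝒜} (hG : IsZero G) : IsGorensteinInjective G := by
  have hs (A B C : 𝒜) (hA : IsZero A) (hB : IsZero B) (hC : IsZero C) : InjStep A C := by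
    refine ⟨B, 0, 0, by simp, { exact := ?_, mono_f := ?_, epi_g := ?_ },
      ⟨fun f g _ ↦ ⟨0, hB.eq_of_tgt _ _⟩⟩, fun I _ f ↦ ⟨0, hC.eq_of_tgt _ _⟩⟩
    · exact ShortComplex.exact_of_isZero_X₂ _ hB
    · exact ⟨fun _ _ _ ↦ hA.eq_of_tgt _ _⟩
    · exact ⟨fun _ _ _ ↦ hC.eq_of_src _ _⟩
  exact isGorensteinInjective_of_class IsZero (fun G hG ↦ ⟨G, hG, hs G G G hG hG hG⟩)
    (fun G hG ↦ ⟨G, hG, hs G G G hG hG hG⟩) hG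

lemma isGorensteinInjective_of_injective {G : 𝒜} [hi : Injective G] : IsGorensteinInjective G := by
  refine isGorensteinInjective_of_class (fun X ↦ Injective X)
    (fun X hX ↦ ⟨0, inferInstance, X, 0, 𝟙 X, by simp, shortExact_zero_id X, hX, fun I _ f ↦ ⟨f, by simp⟩⟩)
    (fun X hX ↦ ⟨0, inferInstance, X, 𝟙 X, 0, by simp, shortExact_id_zero X, hX,
      fun I _ f ↦ ⟨0, (isZero_zero 𝒜).eq_of_tgt _ _⟩⟩) hi

/-- If `p` is an epimorphism, the kernel of `(p, g)` is an extension of the source of `g` by the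
kernel of `p`. -/
lemma IsGorensteinInjective.kernel_biprod_desc {K E E' G L : 𝒜} (hK : IsGorensteinInjective K)
    {k : K ⟶ E} {p : E ⟶ G} {w : k ≫ p = 0} (hs : (ShortComplex.mk k p w).ShortExact)
    (hE : Injective E') (g : E' ⟶ G) {l : L ⟶ E ⊞ E'} {w' : l ≫ biprod.desc p g = 0}
    (hl : (ShortComplex.mk l (biprod.desc p g) w').ShortExact) : IsGorensteinInjective L := by
  let ψ : ShortComplex.mk (biprod.inl : E ⟶ E ⊞ E') (biprod.snd : E ⊞ E' ⟶ E') (by simp) ⟶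
      ShortComplex.mk (𝟙 G) (0 : G ⟶ 0) (by simp) :=
    { τ₁ := p
      τ₂ := biprod.desc p g
      τ₃ := 0 }
  obtain ⟨f', g', w', hs', -, -⟩ :=
    exists_shortExact_of_kernels ψ (shortExact_biprod E E') (shortExact_id_zero G) hs hl
      (shortExact_id_zero E')
  exact hK.of_shortExact isGorensteinInjective_of_injective hs'

/-- If `i` is a monomorphism, the cokernel of `(u, i)` is an extension of the cokernel of `i` by the
target of `u`. -/
lemma IsGorensteinInjective.cokernel_biprod_lift {Q E E' G L : 𝒜} (hQ : IsGorensteinInjective Q)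
    {i : G ⟶ E'} {q : E' ⟶ Q} {w : i ≫ q = 0} (hs : (ShortComplex.mk i q w).ShortExact)
    (hE : Injective E) (u : G ⟶ E) {l : E ⊞ E' ⟶ L} {w' : biprod.lift u i ≫ l = 0}
    (hl : (ShortComplex.mk (biprod.lift u i) l w').ShortExact) : IsGorensteinInjective L := by
  let ψ : ShortComplex.mk (0 : 0 ⟶ G) (𝟙 G) (by simp) ⟶
      ShortComplex.mk (biprod.inl : E ⟶ E ⊞ E') (biprod.snd : E ⊞ E' ⟶ E') (by simp) :=
    { τ₁ := 0
      τ₂ := biprod.lift u i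
      τ₃ := i }
  obtain ⟨f', g', w', hs', -, -⟩ :=
    exists_shortExact_of_cokernels ψ (shortExact_zero_id G) (shortExact_biprod E E')
      (shortExact_zero_id E) hl hs
  exact isGorensteinInjective_of_injective.of_shortExact hQ hs'

end Extensions

section Disc

variable {𝒜 : Type*} [Category 𝒜] [Abelian 𝒜]

/-- The direct sum of the complexes `0 ⟶ I n ⟶ I n ⟶ 0` in degrees `n` and `n - 1`. -/
noncomputable def discs (I : ℤ → 𝒜) : ChainComplex 𝒜 ℤ where
  X n := I n ⊞ I (n + 1)
  d i j := if h : j + 1 = i then biprod.fst ≫ eqToHom (congrArg I h.symm) ≫ biprod.inr else 0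
  shape _ _ h := dif_neg h
  d_comp_d' := by
    rintro i j k (rfl : _ = _) (rfl : _ = _)
    simp

/-- The inclusion of the first summand. -/
noncomputable def discsInl (I : ℤ → 𝒜) (n : ℤ) : I n ⟶ (discs I).X n :=
  (biprod.inl : I n ⟶ I n ⊞ I (n + 1))

/-- The inclusion of the second summand. -/
noncomputable def discsInr (I : ℤ → 𝒜) (n : ℤ) : I (n + 1) ⟶ (discs I).X n :=
  (biprod.inr : I (n + 1) ⟶ I n ⊞ I (n + 1))

/-- The projection onto the first summand. -/
noncomputable def discsFst (I : ℤ → 𝒜) (n : ℤ) : (discs I).X n ⟶ I n :=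
  (biprod.fst : I n ⊞ I (n + 1) ⟶ I n)

/-- The projection onto the second summand. -/
noncomputable def discsSnd (I : ℤ → 𝒜) (n : ℤ) : (discs I).X n ⟶ I (n + 1) :=
  (biprod.snd : I n ⊞ I (n + 1) ⟶ I (n + 1))

lemma discsInl_d (I : ℤ → 𝒜) (n : ℤ) :
    discsInl I (n + 1) ≫ (discs I).d (n + 1) n = discsInr I n := by
  simp [discs, discsInl, discsInr]

lemma discsInr_d (I : ℤ → 𝒜) (n : ℤ) : discsInr I (n + 1) ≫ (discs I).d (n + 1) n = 0 := by
  simp [discs, discsInr]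
  rfl

lemma discs_d_snd (I : ℤ → 𝒜) (n : ℤ) :
    (discs I).d (n + 1) n ≫ discsSnd I n = discsFst I (n + 1) := by
  simp [discs, discsSnd, discsFst]

lemma discs_d_fst (I : ℤ → 𝒜) (n : ℤ) : (discs I).d (n + 1) n ≫ discsFst I n = 0 := by
  simp [discs, discsFst]
  rfl

lemma discs_X_hom_ext {I : ℤ → 𝒜} {n : ℤ} {T : 𝒜} {f g : (discs I).X n ⟶ T}
    (h₁ : discsInl I n ≫ f = discsInl I n ≫ g) (h₂ : discsInr I n ≫ f = discsInr I n ≫ g) : f = g :=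
  biprod.hom_ext' (X := I n) (Y := I (n + 1)) f g h₁ h₂

lemma hom_discs_X_ext {I : ℤ → 𝒜} {n : ℤ} {T : 𝒜} {f g : T ⟶ (discs I).X n}
    (h₁ : f ≫ discsFst I n = g ≫ discsFst I n) (h₂ : f ≫ discsSnd I n = g ≫ discsSnd I n) : f = g :=
  biprod.hom_ext (X := I n) (Y := I (n + 1)) f g h₁ h₂

/-- The component of `discsDesc`. -/
noncomputable def discsDescX {I : ℤ → 𝒜} {T : 𝒜} {n : ℤ} (f : I n ⟶ T) (g : I (n + 1) ⟶ T) :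
    (discs I).X n ⟶ T := biprod.desc f g

/-- The component of `discsLift`. -/
noncomputable def discsLiftX {I : ℤ → 𝒜} {T : 𝒜} {n : ℤ} (f : T ⟶ I n) (g : T ⟶ I (n + 1)) :
    T ⟶ (discs I).X n := biprod.lift f g

@[simp]
lemma discsInl_descX {I : ℤ → 𝒜} {T : 𝒜} {n : ℤ} (f : I n ⟶ T) (g : I (n + 1) ⟶ T) :
    discsInl I n ≫ discsDescX f g = f := biprod.inl_desc _ _

@[simp]
lemma discsInr_descX {I : ℤ → 𝒜} {T : 𝒜} {n : ℤ} (f : I n ⟶ T) (g : I (n + 1) ⟶ T) :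
    discsInr I n ≫ discsDescX f g = g := biprod.inr_desc _ _

@[simp]
lemma discsLiftX_fst {I : ℤ → 𝒜} {T : 𝒜} {n : ℤ} (f : T ⟶ I n) (g : T ⟶ I (n + 1)) :
    discsLiftX f g ≫ discsFst I n = f := biprod.lift_fst _ _

@[simp]
lemma discsLiftX_snd {I : ℤ → 𝒜} {T : 𝒜} {n : ℤ} (f : T ⟶ I n) (g : T ⟶ I (n + 1)) :
    discsLiftX f g ≫ discsSnd I n = g := biprod.lift_snd _ _

/-- The morphism out of `discs I` with prescribed restriction to each `I n`. -/
noncomputable def discsDesc {I : ℤ → 𝒜} {Y : ChainComplex 𝒜 ℤ} (f : ∀ n, I n ⟶ Y.X n) :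
    discs I ⟶ Y where
  f n := discsDescX (f n) (f (n + 1) ≫ Y.d (n + 1) n)
  comm' := by
    rintro i j (rfl : _ = _)
    apply discs_X_hom_ext
    · simp [reassoc_of% discsInl_d, reassoc_of% discsInl_descX]
    · simp [reassoc_of% discsInr_d, reassoc_of% discsInr_descX]

lemma discsInl_desc {I : ℤ → 𝒜} {Y : ChainComplex 𝒜 ℤ} (f : ∀ n, I n ⟶ Y.X n) (n : ℤ) :
    discsInl I n ≫ (discsDesc f).f n = f n := discsInl_descX _ _

lemma discs_hom_ext {I : ℤ → 𝒜} {Y : ChainComplex 𝒜 ℤ} {f g : discs I ⟶ Y}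
    (h : ∀ n, discsInl I n ≫ f.f n = discsInl I n ≫ g.f n) : f = g := by
  ext n : 1
  refine discs_X_hom_ext (h n) ?_
  rw [← discsInl_d, Category.assoc, Category.assoc, ← f.comm, ← g.comm, reassoc_of% h]

/-- The morphism into `discs I` with prescribed component at each `I n`. -/
noncomputable def discsLift {I : ℤ → 𝒜} {Y : ChainComplex 𝒜 ℤ}
    (f : ∀ n m, n + 1 = m → (Y.X n ⟶ I m)) : Y ⟶ discs I where
  f n := discsLiftX (Y.d n (n - 1) ≫ f (n - 1) n (by omega)) (f n (n + 1) rfl)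
  comm' := by
    rintro i j (rfl : _ = _)
    have (k : ℤ) (hk : k = j) (h : k + 1 = j + 1) : Y.d (j + 1) k ≫ f k (j + 1) h =
      Y.d (j + 1) j ≫ f j (j + 1) rfl := by subst hk; rfl
    apply hom_discs_X_ext
    · simp [discs_d_fst]
    · simp [discs_d_snd, this]

lemma discsLift_snd {I : ℤ → 𝒜} {Y : ChainComplex 𝒜 ℤ}
    (f : ∀ n m, n + 1 = m → (Y.X n ⟶ I m)) (n : ℤ) :
    (discsLift f).f n ≫ discsSnd I n = f n (n + 1) rfl := discsLiftX_snd _ _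

lemma hom_discs_ext {I : ℤ → 𝒜} {Y : ChainComplex 𝒜 ℤ} {f g : Y ⟶ discs I}
    (h : ∀ n, f.f n ≫ discsSnd I n = g.f n ≫ discsSnd I n) : f = g := by
  ext n : 1
  refine hom_discs_X_ext ?_ (h n)
  obtain ⟨n, rfl⟩ : ∃ k, n = k + 1 := ⟨n - 1, by simp⟩
  rw [← discs_d_snd, f.comm_assoc, g.comm_assoc, h]

lemma injective_discs {I : ℤ → 𝒜} (hI : ∀ n, Injective (I n)) : Injective (discs I) where
  factors {X Y} g f hf := by
    have hf' (n) : Mono (f.f n) := inferInstance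
    refine ⟨discsLift fun n m h ↦ Injective.factorThru
      (g.f n ≫ discsSnd I n ≫ eqToHom (congrArg I h)) (f.f n), ?_⟩
    apply hom_discs_ext
    intro n
    rw [HomologicalComplex.comp_f, Category.assoc, discsLift_snd]
    simp

lemma projective_discs {I : ℤ → 𝒜} (hI : ∀ n, Projective (I n)) : Projective (discs I) where
  factors {X Y} g f hf := by
    have hf' (n) : Epi (f.f n) := inferInstance
    refine ⟨discsDesc fun n ↦ Projective.factorThru (discsInl I n ≫ g.f n) (f.f n), ?_⟩
    apply discs_hom_ext
    intro n
    rw [HomologicalComplex.comp_f, reassoc_of% discsInl_desc]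
    simp

lemma shortExact_components {S : ShortComplex (ChainComplex 𝒜 ℤ)} (hS : S.ShortExact) (n : ℤ) :
    (ShortComplex.mk (S.f.f n) (S.g.f n)
      (by rw [← HomologicalComplex.comp_f, S.zero]; rfl)).ShortExact :=
  hS.map_of_exact (HomologicalComplex.eval _ _ n)

variable [EnoughInjectives 𝒜]

lemma exists_retract_discs (E : ChainComplex 𝒜 ℤ) [Injective E] :
    ∃ (I : ℤ → 𝒜) (_ : ∀ n, Injective (I n)) (s : E ⟶ discs I) (r : discs I ⟶ E), s ≫ r = 𝟙 E := by
  let I : ℤ → 𝒜 := fun n ↦ Injective.under (E.X (n - 1))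
  have hI : ∀ n, Injective (I n) := fun n ↦ inferInstanceAs (Injective (Injective.under _))
  let s : E ⟶ discs I := discsLift fun n m h ↦
    Injective.ι (E.X n) ≫ eqToHom (by subst h; simp [I])
  have (n : ℤ) : Mono (s.f n) := by
    have h : s.f n ≫ discsSnd I n = Injective.ι (E.X n) ≫ eqToHom (by simp [I]) :=
      discsLift_snd _ _
    have : Mono (s.f n ≫ discsSnd I n) := by rw [h]; infer_instance
    exact mono_of_mono _ (discsSnd I n)
  have : Mono s := HomologicalComplex.mono_of_mono_f s inferInstance
  exact ⟨I, hI, s, Injective.factorThru (𝟙 E) s, Injective.comp_factorThru _ _⟩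

lemma injective_X (E : ChainComplex 𝒜 ℤ) [Injective E] (n : ℤ) : Injective (E.X n) := by
  obtain ⟨I, hI, s, r, h⟩ := exists_retract_discs E
  have : Injective ((discs I).X n) := inferInstanceAs (Injective (I n ⊞ I (n + 1)))
  exact Retract.injective (Y := (discs I).X n) ⟨s.f n, r.f n, by simp [← HomologicalComplex.comp_f, h]⟩

lemma exists_lift_of_components {X Y : ChainComplex 𝒜 ℤ} (p : X ⟶ Y)
    (hp : ∀ n (I : 𝒜), Injective I → ∀ f : I ⟶ Y.X n, ∃ l : I ⟶ X.X n, l ≫ p.f n = f)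
    (J : ChainComplex 𝒜 ℤ) [Injective J] (f : J ⟶ Y) : ∃ l : J ⟶ X, l ≫ p = f := by
  obtain ⟨I, hI, s, r, h⟩ := exists_retract_discs J
  choose l hl using fun n ↦ hp n (I n) (hI n) (discsInl I n ≫ (r ≫ f).f n)
  refine ⟨s ≫ discsDesc l, ?_⟩
  have : discsDesc l ≫ p = r ≫ f := by
    apply discs_hom_ext
    intro n
    rw [HomologicalComplex.comp_f, ← hl n, reassoc_of% discsInl_desc]
  rw [Category.assoc, this, reassoc_of% h]

lemma isGorensteinInjective_of_components {G : ChainComplex 𝒜 ℤ}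
    (hG : ∀ n, IsGorensteinInjective (G.X n)) : IsGorensteinInjective G := by
  refine isGorensteinInjective_of_class (fun G : ChainComplex 𝒜 ℤ ↦
    ∀ n, IsGorensteinInjective (G.X n)) ?_ ?_ hG
  · intro G hG
    choose A hA E i p w hs hE hl using fun n ↦ (hG n).exists_injStep_left
    have hp (n) : Epi (p n) := (hs n).epi_g
    let q : discs E ⟶ G := discsDesc p
    have hq (n : ℤ) : Epi (q.f n) := by
      have : Epi (discsInl E n ≫ q.f n) := by
        have h : discsInl E n ≫ q.f n = p n := discsInl_desc _ _
        rw [h]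
        infer_instance
      exact epi_of_epi (discsInl E n) (q.f n)
    have : Epi q := HomologicalComplex.epi_of_epi_f q inferInstance
    have hse : (ShortComplex.mk (kernel.ι q) q (kernel.condition q)).ShortExact :=
      { exact := ShortComplex.exact_of_f_is_kernel _ (kernelIsKernel q)
        mono_f := inferInstanceAs (Mono (kernel.ι q))
        epi_g := this }
    have hK (n : ℤ) : IsGorensteinInjective ((kernel q).X n) :=
      (hA n).kernel_biprod_desc (hs n) (hE (n + 1)) _ (shortExact_components hse n)
    refine ⟨kernel q, hK, _, _, _, _, hse, injective_discs hE, fun J hJ f ↦ ?_⟩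
    exact exists_lift_of_components _ (fun n I hI f ↦
      (hK n).exists_lift (shortExact_components hse n) hI f) J f
  · intro G hG
    choose A hA E i p w hs hE hl using fun n ↦ (hG n).exists_injStep_right
    have hi (n) : Mono (i n) := (hs n).mono_f
    let I : ℤ → 𝒜 := fun n ↦ E (n - 1)
    have hI (n) : Injective (I n) := hE _
    let q : G ⟶ discs I := discsLift fun n m h ↦ i n ≫ eqToHom (by subst h; simp [I])
    have hq (n : ℤ) : Mono (q.f n) := by
      have h : q.f n ≫ discsSnd I n = i n ≫ eqToHom (by simp [I]) :=
        discsLift_snd _ _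
      have : Mono (q.f n ≫ discsSnd I n) := by rw [h]; infer_instance
      exact mono_of_mono (q.f n) (discsSnd I n)
    have : Mono q := HomologicalComplex.mono_of_mono_f q inferInstance
    have hse : (ShortComplex.mk q (cokernel.π q) (cokernel.condition q)).ShortExact :=
      { exact := ShortComplex.exact_of_g_is_cokernel _ (cokernelIsCokernel q)
        mono_f := this
        epi_g := inferInstanceAs (Epi (cokernel.π q)) }
    have hs' (n : ℤ) : (ShortComplex.mk (i n ≫ eqToHom (by simp [I]) : G.X n ⟶ I (n + 1))
        (eqToHom (by simp [I]) ≫ p n) (by simp [w])).ShortExact := by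
      have φ : ShortComplex.mk (i n) (p n) (w n) ≅ ShortComplex.mk
          (i n ≫ eqToHom (by simp [I]) : G.X n ⟶ I (n + 1))
          (eqToHom (by simp [I]) ≫ p n) (by simp [w]) :=
        ShortComplex.isoMk (Iso.refl _) (eqToIso (by simp [I])) (Iso.refl _) (by simp) (by simp)
      exact ShortComplex.shortExact_of_iso φ (hs n)
    have hK (n : ℤ) : IsGorensteinInjective ((cokernel q).X n) :=
      (hA n).cokernel_biprod_lift (hs' n) (hI n) _ (shortExact_components hse n)
    refine ⟨cokernel q, hK, _, _, _, _, hse, injective_discs hI, fun J hJ f ↦ ?_⟩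
    exact exists_lift_of_components _ (fun n I hI f ↦
      (hG n).exists_lift (shortExact_components hse n) hI f) J f

lemma IsGorensteinInjective.components {G : ChainComplex 𝒜 ℤ} (hG : IsGorensteinInjective G)
    (n : ℤ) : IsGorensteinInjective (G.X n) := by
  obtain ⟨Z, ⟨e⟩, hZ⟩ := hG.exists_injSteps
  refine isGorensteinInjective_of_injSteps (fun k ↦ (Z k).X n)
    ((HomologicalComplex.eval _ _ n).mapIso e) fun i j hij ↦ ?_
  obtain ⟨E, ι, p, w, hs, hE, hl⟩ := hZ i j hij
  refine ⟨E.X n, ι.f n, p.f n, _, shortExact_components hs n, injective_X E n, fun I hI f ↦ ?_⟩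
  obtain ⟨l, hl⟩ := hl (discs fun _ ↦ I) (injective_discs fun _ ↦ hI)
    (discsDesc (Function.update 0 n f))
  refine ⟨discsInl (fun _ ↦ I) n ≫ l.f n, ?_⟩
  rw [Category.assoc, ← HomologicalComplex.comp_f, hl, discsInl_desc]
  simp

end Disc

section SmallSubmodules

/-- Terms built from one generator of each sort, the module operations, and operation symbols `o`
of arity `A o`, source sort `s o` and target sort `t o`. -/
inductive SortedTerm (R : Type u) {P : Type} {O : Type u} (s t : O → P) (A : O → Type u) :
    P → Type u
  | zero (p : P) : SortedTerm R s t A p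
  | gen (p : P) : SortedTerm R s t A p
  | add {p : P} (x y : SortedTerm R s t A p) : SortedTerm R s t A p
  | smul {p : P} (r : R) (x : SortedTerm R s t A p) : SortedTerm R s t A p
  | op (o : O) (f : A o → SortedTerm R s t A (s o)) : SortedTerm R s t A (t o)

variable {R : Type u} [Ring R]

/-- Evaluation of a term in a family of modules equipped with operations. -/
def SortedTerm.eval {P : Type} {O : Type u} {s t : O → P} {A : O → Type u}
    {M : P → Type u} [∀ p, AddCommGroup (M p)] [∀ p, Module R (M p)]
    (F : ∀ o, (A o → M (s o)) → M (t o)) (g : ∀ p, M p) {p : P} : SortedTerm R s t A p → M p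
  | .zero _ => 0
  | .gen p => g p
  | .add x y => x.eval F g + y.eval F g
  | .smul r x => r • x.eval F g
  | .op o f => F o fun a ↦ (f a).eval F g

lemma exists_small_closed_submodules {P : Type} {O : Type u} (s t : O → P) (A : O → Type u) :
    ∃ W : Type u, ∀ (M : P → Type u) [∀ p, AddCommGroup (M p)] [∀ p, Module R (M p)]
      (F : ∀ o, (A o → M (s o)) → M (t o)) (g : ∀ p, M p),
      ∃ T : ∀ p, Submodule R (M p), (∀ p, g p ∈ T p) ∧
        (∀ p, ∃ f : W → T p, Function.Surjective f) ∧
        ∀ o φ, (∀ a, φ a ∈ T (s o)) → F o φ ∈ T (t o) := by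
  classical
  refine ⟨Σ p, SortedTerm R s t A p, fun M _ _ F g ↦ ?_⟩
  let T : ∀ p, Submodule R (M p) := fun p ↦
    { carrier := Set.range fun x : SortedTerm R s t A p ↦ x.eval F g
      zero_mem' := ⟨.zero p, rfl⟩
      add_mem' := by
        rintro _ _ ⟨x, rfl⟩ ⟨y, rfl⟩
        exact ⟨x.add y, rfl⟩
      smul_mem' := by
        rintro r _ ⟨x, rfl⟩
        exact ⟨x.smul r, rfl⟩ }
  refine ⟨T, fun p ↦ ⟨.gen p, rfl⟩, fun p ↦ ?_, fun o φ hφ ↦ ?_⟩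
  · refine ⟨fun w ↦ if h : w.1 = p then ⟨(h ▸ w.2).eval F g, ⟨_, rfl⟩⟩ else 0, ?_⟩
    rintro ⟨_, x, rfl⟩
    exact ⟨⟨p, x⟩, by simp⟩
  · choose x hx using hφ
    exact ⟨.op o x, by simp only [SortedTerm.eval]; congr 1; exact funext hx⟩

lemma Module.Injective.of_linearEquiv {Q Q' : Type u} [AddCommGroup Q] [Module R Q]
    [AddCommGroup Q'] [Module R Q'] (h : Module.Injective R Q) (e : Q ≃ₗ[R] Q') :
    Module.Injective R Q' := by
  refine Module.Baer.injective fun 𝔞 g ↦ ?_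
  obtain ⟨g', hg'⟩ := Module.Baer.of_injective h 𝔞 (e.symm.toLinearMap ∘ₗ g)
  exact ⟨e.toLinearMap ∘ₗ g', fun x hx ↦ by simp [hg' x hx]⟩

/-- The (choice) operation on a module solving `a • x = φ a` for all `a` in a left ideal. -/
noncomputable def baerOp {E : Type u} [AddCommGroup E] [Module R E] (𝔞 : Ideal R) (φ : 𝔞 → E) :
    E :=
  open Classical in if h : ∃ x : E, ∀ a : 𝔞, (a : R) • x = φ a then h.choose else 0

lemma injective_of_baerOp_mem {E : Type u} [AddCommGroup E] [Module R E]
    (hE : Module.Injective R E) (T : Submodule R E)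
    (hT : ∀ (𝔞 : Ideal R) (φ : 𝔞 → E), (∀ a, φ a ∈ T) → baerOp 𝔞 φ ∈ T) :
    Module.Injective R T := by
  refine Module.Baer.injective fun 𝔞 g ↦ ?_
  obtain ⟨g', hg'⟩ := Module.Baer.of_injective hE 𝔞 (T.subtype ∘ₗ g)
  have h : ∃ x : E, ∀ a : 𝔞, (a : R) • x = (g a : E) := ⟨g' 1, fun a ↦ by
    rw [← map_smul, smul_eq_mul, mul_one, hg' _ a.2]; rfl⟩
  have hm := hT 𝔞 (fun a ↦ g a) (fun a ↦ (g a).2)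
  have hb : baerOp 𝔞 (fun a ↦ (g a : E)) = h.choose := dif_pos h
  rw [hb] at hm
  refine ⟨LinearMap.toSpanSingleton R T ⟨_, hm⟩, fun x hx ↦ ?_⟩
  ext
  exact h.choose_spec ⟨x, hx⟩

lemma exists_small_injective_submodule (R : Type u) [Ring R] :
    ∃ W : Type u, ∀ (I : Type u) [AddCommGroup I] [Module R I], Module.Injective R I →
      ∀ x : I, ∃ J : Submodule R I, x ∈ J ∧ Module.Injective R J ∧
        ∃ f : W → J, Function.Surjective f := by
  obtain ⟨W, hW⟩ := exists_small_closed_submodules (R := R) (P := Unit) (O := Ideal R)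
    (fun _ ↦ ()) (fun _ ↦ ()) (fun 𝔞 ↦ 𝔞)
  refine ⟨W, fun I _ _ hI x ↦ ?_⟩
  obtain ⟨T, hx, hs, hT⟩ := hW (fun _ ↦ I) (fun 𝔞 φ ↦ baerOp 𝔞 φ) (fun _ ↦ x)
  exact ⟨T (), hx (), injective_of_baerOp_mem hI _ hT, hs ()⟩

lemma exists_linearEquiv_quotient {W J : Type u} [AddCommGroup J] [Module R J] (f : W → J)
    (hf : Function.Surjective f) :
    ∃ N : Submodule R (W →₀ R), Nonempty (((W →₀ R) ⧸ N) ≃ₗ[R] J) := by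
  refine ⟨_, ⟨(Finsupp.linearCombination R f).quotKerEquivOfSurjective ?_⟩⟩
  intro x
  obtain ⟨w, rfl⟩ := hf x
  exact ⟨Finsupp.single w 1, by simp⟩

lemma injective_sSup_of_directedOn [IsNoetherianRing R] {E : Type u} [AddCommGroup E] [Module R E]
    (c : Set (Submodule R E)) (hne : c.Nonempty) (hc : DirectedOn (· ≤ ·) c)
    (hinj : ∀ D ∈ c, Module.Injective R D) : Module.Injective R (sSup c : Submodule R E) := by
  refine Module.Baer.injective fun 𝔞 g ↦ ?_
  obtain ⟨D, hD, hle⟩ : ∃ D ∈ c, LinearMap.range ((sSup c).subtype ∘ₗ g) ≤ D := by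
    have hfg : (LinearMap.range ((sSup c).subtype ∘ₗ g)).FG := by
      rw [LinearMap.range_eq_map]
      exact Submodule.FG.map _ ((Module.finite_def).1 inferInstance)
    obtain ⟨F, hF⟩ := hfg
    have hmem : ∀ x ∈ F, x ∈ sSup c := fun x hx ↦ by
      have : x ∈ LinearMap.range ((sSup c).subtype ∘ₗ g) := hF ▸ Submodule.subset_span hx
      obtain ⟨y, rfl⟩ := this
      exact (g y).2
    have : ∃ D ∈ c, ∀ x ∈ F, x ∈ D := by
      classical
      clear hF
      induction F using Finset.induction_on with
      | empty => exact ⟨_, hne.choose_spec, by simp⟩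
      | insert a F _ ih =>
        obtain ⟨D, hD, h⟩ := ih fun x hx ↦ hmem x (Finset.mem_insert_of_mem hx)
        obtain ⟨D', hD', h'⟩ := (Submodule.mem_sSup_of_directed hne hc).1
          (hmem a (Finset.mem_insert_self _ _))
        obtain ⟨D'', hD'', h1, h2⟩ := hc D hD D' hD'
        refine ⟨D'', hD'', fun x hx ↦ ?_⟩
        rcases Finset.mem_insert.1 hx with rfl | hx
        exacts [h2 h', h1 (h x hx)]
    obtain ⟨D, hD, h⟩ := this
    exact ⟨D, hD, by rw [← hF]; exact Submodule.span_le.2 h⟩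
  have hmem : ∀ a, ((g a : (sSup c : Submodule R E)) : E) ∈ D := fun a ↦ hle ⟨a, rfl⟩
  obtain ⟨g', hg'⟩ := Module.Baer.of_injective (hinj D hD) 𝔞
    (((sSup c).subtype ∘ₗ g).codRestrict D hmem)
  exact ⟨Submodule.inclusion (le_sSup hD) ∘ₗ g', fun x hx ↦
    Subtype.ext (congrArg Subtype.val (hg' x hx) :)⟩

/-- Lifting against small injective modules implies lifting against all injective modules. -/
lemma exists_lift_of_small [IsNoetherianRing R] {W : Type u}
    (hW : ∀ (I : Type u) [AddCommGroup I] [Module R I], Module.Injective R I →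
      ∀ x : I, ∃ J : Submodule R I, x ∈ J ∧ Module.Injective R J ∧
        ∃ f : W → J, Function.Surjective f)
    {C Z : Type u} [AddCommGroup C] [Module R C] [AddCommGroup Z] [Module R Z] (g : C →ₗ[R] Z)
    (hg : ∀ N : Submodule R (W →₀ R), Module.Injective R ((W →₀ R) ⧸ N) →
      ∀ f : ((W →₀ R) ⧸ N) →ₗ[R] Z, ∃ l : ((W →₀ R) ⧸ N) →ₗ[R] C, g ∘ₗ l = f)
    {I : Type u} [AddCommGroup I] [Module R I] (hI : Module.Injective R I) (f : I →ₗ[R] Z) :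
    ∃ l : I →ₗ[R] C, g ∘ₗ l = f := by
  have hg' : ∀ (J : Submodule R I), Module.Injective R J → (∃ q : W → J, Function.Surjective q) →
      ∃ l : J →ₗ[R] C, ∀ x, g (l x) = f x := by
    rintro J hJ ⟨q, hq⟩
    obtain ⟨N, ⟨e⟩⟩ := exists_linearEquiv_quotient (R := R) q hq
    obtain ⟨l, hl⟩ := hg N (hJ.of_linearEquiv e.symm) (f ∘ₗ J.subtype ∘ₗ e.toLinearMap)
    refine ⟨l ∘ₗ e.symm.toLinearMap, fun x ↦ ?_⟩
    simpa using LinearMap.congr_fun hl (e.symm x)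
  let 𝒮 : Set (I →ₗ.[R] C) := {l | Module.Injective R l.domain ∧ ∀ x, g (l x) = f x}
  have hbot : (⊥ : I →ₗ.[R] C) ∈ 𝒮 := by
    refine ⟨?_, fun x ↦ ?_⟩
    · have : Subsingleton (⊥ : I →ₗ.[R] C).domain :=
        inferInstanceAs (Subsingleton (⊥ : Submodule R I))
      exact Module.Baer.injective fun 𝔞 g ↦ ⟨0, fun x hx ↦ Subsingleton.elim _ _⟩
    · have hx : (x : I) = 0 := (Submodule.mem_bot R).1 x.2
      obtain rfl : x = 0 := by ext; exact hx
      simp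
  obtain ⟨m, hm⟩ : ∃ m, Maximal (· ∈ 𝒮) m := by
    refine zorn_le₀ 𝒮 fun c hc hchain ↦ ?_
    rcases c.eq_empty_or_nonempty with rfl | hne
    · exact ⟨⊥, hbot, by simp⟩
    · have hdir : DirectedOn (· ≤ ·) c := hchain.directedOn
      refine ⟨LinearPMap.sSup c hdir, ⟨?_, fun x ↦ ?_⟩, fun l hl ↦ LinearPMap.le_sSup hdir hl⟩
      · refine injective_sSup_of_directedOn _ (hne.image _) ?_ ?_
        · rintro _ ⟨a, ha, rfl⟩ _ ⟨b, hb, rfl⟩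
          obtain ⟨d, hd, h1, h2⟩ := hdir a ha b hb
          exact ⟨_, ⟨d, hd, rfl⟩, h1.1, h2.1⟩
        · rintro _ ⟨a, ha, rfl⟩
          exact (hc ha).1
      · obtain ⟨a, ha, hxa⟩ := (LinearPMap.mem_domain_sSup_iff hne hdir).1 x.2
        have := (LinearPMap.le_sSup hdir ha).2 (x := ⟨x, hxa⟩) (y := x) rfl
        rw [← this]
        exact (hc ha).2 ⟨x, hxa⟩
  suffices hd : m.domain = ⊤ by
    refine ⟨m.toFun ∘ₗ (LinearEquiv.ofTop _ hd).symm.toLinearMap, ?_⟩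
    ext x
    exact hm.1.2 ⟨x, hd ▸ Submodule.mem_top⟩
  have hcompl : ∃ D', IsCompl m.domain D' := by
    obtain ⟨r, hr⟩ := hm.1.1.out m.domain.subtype (Submodule.subtype_injective _) LinearMap.id
    exact ⟨LinearMap.ker r, LinearMap.isCompl_of_proj hr⟩
  obtain ⟨D', hD'⟩ := hcompl
  by_contra hne
  obtain ⟨x, hxD', hx⟩ : ∃ x ∈ D', x ≠ 0 := by
    refine (Submodule.ne_bot_iff _).1 fun h ↦ hne ?_
    rw [h] at hD'
    exact (codisjoint_bot.1 hD'.2)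
  have hD'inj : Module.Injective R D' := by
    refine Module.Baer.injective fun 𝔞 k ↦ ?_
    obtain ⟨k', hk'⟩ := Module.Baer.of_injective hI 𝔞 (D'.subtype ∘ₗ k)
    refine ⟨(D'.projectionOnto m.domain hD'.symm) ∘ₗ k', fun y hy ↦ ?_⟩
    simp [hk' y hy]
  obtain ⟨J, hxJ, hJ, q, hq⟩ := hW D' hD'inj ⟨x, hxD'⟩
  let J' := J.map D'.subtype
  let e : J ≃ₗ[R] J' := J.equivMapOfInjective _ (Submodule.subtype_injective _)
  have hJ' : Module.Injective R J' := hJ.of_linearEquiv e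
  obtain ⟨l, hl⟩ := hg' J' hJ' ⟨e ∘ q, e.surjective.comp hq⟩
  have hJD : J' ≤ D' := by
    rintro _ ⟨y, -, rfl⟩
    exact y.2
  have hdisj : Disjoint m.domain J' := hD'.1.mono_right hJD
  let l' : I →ₗ.[R] C := ⟨J', l⟩
  let s := m.sup l' (m.sup_h_of_disjoint l' hdisj)
  have hs : s ∈ 𝒮 := by
    refine ⟨?_, fun y ↦ ?_⟩
    · let e : (m.domain × J') ≃ₗ[R] (m.domain ⊔ J' : Submodule R I) :=
        LinearEquiv.ofBijective
          ((m.domain.subtype.coprod J'.subtype).codRestrict _ fun y ↦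
            Submodule.add_mem_sup y.1.2 y.2.2) ⟨?_, ?_⟩
      · refine Module.Injective.of_linearEquiv ?_ e
        have := hm.1.1
        have : Module.Injective R m.domain := hm.1.1
        refine Module.Baer.injective fun 𝔞 k ↦ ?_
        obtain ⟨k₁, h₁⟩ := Module.Baer.of_injective hm.1.1 𝔞 (LinearMap.fst R _ _ ∘ₗ k)
        obtain ⟨k₂, h₂⟩ := Module.Baer.of_injective hJ' 𝔞 (LinearMap.snd R _ _ ∘ₗ k)
        exact ⟨k₁.prod k₂, fun y hy ↦ by ext <;> simp [h₁ y hy, h₂ y hy]⟩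
      · refine (injective_iff_map_eq_zero _).2 fun y hy ↦ ?_
        have hy' : (y.1 : I) + y.2 = 0 := congrArg Subtype.val hy
        have h1 : (y.1 : I) = 0 := Submodule.disjoint_def.1 hdisj _ y.1.2 (by
          rw [eq_neg_of_add_eq_zero_left hy']; exact J'.neg_mem y.2.2)
        have h2 : (y.2 : I) = 0 := by simpa [h1] using hy'
        exact Prod.ext (Subtype.ext h1) (Subtype.ext h2)
      · rintro ⟨y, hy⟩
        obtain ⟨a, ha, b, hb, rfl⟩ := Submodule.mem_sup.1 hy
        exact ⟨(⟨a, ha⟩, ⟨b, hb⟩), rfl⟩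
    · obtain ⟨y, hy⟩ := y
      obtain ⟨a, ha, b, hb, rfl⟩ := Submodule.mem_sup.1 hy
      have := m.sup_apply (m.sup_h_of_disjoint l' hdisj) ⟨a, ha⟩ ⟨b, hb⟩ ⟨_, hy⟩ rfl
      rw [show s ⟨a + b, hy⟩ = _ from this, map_add, hm.1.2 ⟨a, ha⟩]
      change f a + g (l ⟨b, hb⟩) = _
      rw [hl, map_add]
  have hle := hm.2 hs (LinearPMap.left_le_sup _ _ _)
  have hxm : x ∈ m.domain := hle.1 (by
    exact Submodule.mem_sup_right ⟨⟨x, hxD'⟩, hxJ, rfl⟩)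
  exact hx ((Submodule.disjoint_def.1 hD'.1) x hxm hxD')

end SmallSubmodules

section CokernelClosure

open ZeroObject

variable {𝒜 : Type*} [Category 𝒜] [Abelian 𝒜]

lemma shortExact_kernel_comp {L E B C A B' : 𝒜} {p : E ⟶ B} {g : B ⟶ C} {k : B' ⟶ E} {f : A ⟶ B}
    {l : L ⟶ E} {w : k ≫ p = 0} {w' : f ≫ g = 0} {w'' : l ≫ p ≫ g = 0}
    (hp : (ShortComplex.mk k p w).ShortExact) (hg : (ShortComplex.mk f g w').ShortExact)
    (hl : (ShortComplex.mk l (p ≫ g) w'').ShortExact) :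
    ∃ (x : B' ⟶ L) (y : L ⟶ A) (h : x ≫ y = 0), (ShortComplex.mk x y h).ShortExact ∧
      x ≫ l = k := by
  have mk : Mono k := hp.mono_f
  have mf : Mono f := hg.mono_f
  have ml : Mono l := hl.mono_f
  have ep : Epi p := hp.epi_g
  obtain ⟨x, hx⟩ := hl.exists_lift k (by simp [reassoc_of% w])
  obtain ⟨y, hy⟩ := hg.exists_lift (l ≫ p) (by simpa using w'')
  dsimp at x hx y hy
  have h : x ≫ y = 0 := by
    rw [← cancel_mono f, Category.assoc, hy, reassoc_of% hx, w, zero_comp]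
  have mx : Mono x := mono_of_mono_fac hx
  refine ⟨x, y, h, { exact := ?_, mono_f := mx, epi_g := ?_ }, hx⟩
  · refine ShortComplex.exact_of_f_is_kernel _ (KernelFork.IsLimit.ofι' _ _ fun {T} t ht ↦ ?_)
    dsimp at t ht
    have : ∃ u : T ⟶ B', u ≫ k = t ≫ l := hp.exists_lift (t ≫ l) (by
      dsimp; rw [Category.assoc, ← hy, reassoc_of% ht, zero_comp])
    exact ⟨this.choose, by
      dsimp
      rw [← cancel_mono l, Category.assoc, hx, this.choose_spec]⟩
  · obtain ⟨z, hz⟩ := hl.exists_lift (pullback.snd f p) (by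
      dsimp; rw [← reassoc_of% (pullback.condition (f := f) (g := p)), w', comp_zero])
    have : z ≫ y = pullback.fst f p := by
      dsimp at hz
      rw [← cancel_mono f, Category.assoc, hy, reassoc_of% hz, pullback.condition]
    exact epi_of_epi_fac this

lemma shortExact_cokernel_comp {X Y E Z Q P : 𝒜} {a : X ⟶ Y} {k : Y ⟶ E} {b : Y ⟶ Z} {r : E ⟶ P}
    {s : E ⟶ Q} {w : a ≫ b = 0} {w' : k ≫ r = 0} {w'' : (a ≫ k) ≫ s = 0}
    (ha : (ShortComplex.mk a b w).ShortExact) (hk : (ShortComplex.mk k r w').ShortExact)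
    (hs : (ShortComplex.mk (a ≫ k) s w'').ShortExact) :
    ∃ (f : Z ⟶ Q) (g : Q ⟶ P) (h : f ≫ g = 0), (ShortComplex.mk f g h).ShortExact ∧
      b ≫ f = k ≫ s ∧ s ≫ g = r := by
  have eb : Epi b := ha.epi_g
  have er : Epi r := hk.epi_g
  have es : Epi s := hs.epi_g
  have mk : Mono k := hk.mono_f
  have desc₁ {T : 𝒜} (t : Y ⟶ T) (ht : a ≫ t = 0) : ∃ u : Z ⟶ T, b ≫ u = t :=
    ⟨ha.gIsCokernel.desc (CokernelCofork.ofπ t ht), ha.gIsCokernel.fac _ WalkingParallelPair.one⟩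
  have desc₂ {T : 𝒜} (t : E ⟶ T) (ht : k ≫ t = 0) : ∃ u : P ⟶ T, r ≫ u = t :=
    ⟨hk.gIsCokernel.desc (CokernelCofork.ofπ t ht), hk.gIsCokernel.fac _ WalkingParallelPair.one⟩
  have desc₃ {T : 𝒜} (t : E ⟶ T) (ht : (a ≫ k) ≫ t = 0) : ∃ u : Q ⟶ T, s ≫ u = t :=
    ⟨hs.gIsCokernel.desc (CokernelCofork.ofπ t ht), hs.gIsCokernel.fac _ WalkingParallelPair.one⟩
  obtain ⟨f, hf⟩ := desc₁ (k ≫ s) (by simpa using w'')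
  obtain ⟨g, hg⟩ := desc₃ r (by simp [w'])
  have h : f ≫ g = 0 := by
    rw [← cancel_epi b, reassoc_of% hf, hg, w', comp_zero]
  have eg : Epi g := epi_of_epi_fac hg
  refine ⟨f, g, h, { exact := ?_, mono_f := ?_, epi_g := eg }, hf, hg⟩
  · refine ShortComplex.exact_of_g_is_cokernel _ (CokernelCofork.IsColimit.ofπ' _ _
      fun {T} t ht ↦ ?_)
    dsimp at t ht
    have := desc₂ (s ≫ t) (by rw [← reassoc_of% hf, ht, comp_zero])
    exact ⟨this.choose, by
      dsimp
      rw [← cancel_epi s, reassoc_of% hg, this.choose_spec]⟩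
  · obtain ⟨z, hz⟩ := desc₃ (pushout.inr b k) (by
      rw [Category.assoc, ← pushout.condition, reassoc_of% w, zero_comp])
    have : f ≫ z = pushout.inl b k := by
      rw [← cancel_epi b, reassoc_of% hf, hz, pushout.condition]
    exact mono_of_mono_fac this

/-- Gorenstein injective objects are closed under cokernels of monomorphisms. -/
lemma IsGorensteinInjective.cokernel_of_shortExact {A B C : 𝒜} (hA : IsGorensteinInjective A)
    (hB : IsGorensteinInjective B) {f : A ⟶ B} {g : B ⟶ C} {w : f ≫ g = 0}
    (hs : (ShortComplex.mk f g w).ShortExact) : IsGorensteinInjective C := by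
  have of_gi (Q : 𝒜) (hQ : IsGorensteinInjective Q) :
      ∃ (A B : 𝒜) (f : A ⟶ B) (g : B ⟶ Q) (w : f ≫ g = 0), IsGorensteinInjective A ∧
        IsGorensteinInjective B ∧ (ShortComplex.mk f g w).ShortExact :=
    ⟨0, Q, 0, 𝟙 Q, by simp, isGorensteinInjective_of_isZero (isZero_zero _), hQ,
      shortExact_zero_id Q⟩
  refine isGorensteinInjective_of_class
    (fun C ↦ ∃ (A B : 𝒜) (f : A ⟶ B) (g : B ⟶ C) (w : f ≫ g = 0),
      IsGorensteinInjective A ∧ IsGorensteinInjective B ∧ (ShortComplex.mk f g w).ShortExact)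
    ?_ ?_ ⟨A, B, f, g, w, hA, hB, hs⟩
  · rintro C ⟨A, B, f, g, w, hA, hB, hs⟩
    obtain ⟨B', hB', E, k, p, wp, hp, hE, hlp⟩ := hB.exists_injStep_left
    have ep : Epi p := hp.epi_g
    have eg : Epi g := hs.epi_g
    have hl : (ShortComplex.mk (kernel.ι (p ≫ g)) (p ≫ g) (kernel.condition _)).ShortExact :=
      { exact := ShortComplex.exact_of_f_is_kernel _ (kernelIsKernel _)
        mono_f := inferInstanceAs (Mono (kernel.ι _))
        epi_g := inferInstanceAs (Epi (p ≫ g)) }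
    obtain ⟨x, y, h, hxy, -⟩ := shortExact_kernel_comp hp hs hl
    refine ⟨_, of_gi _ (hB'.of_shortExact hA hxy), E, _, _, _, hl, hE, fun I hI t ↦ ?_⟩
    obtain ⟨t', ht'⟩ := hA.exists_lift hs hI t
    obtain ⟨t'', ht''⟩ := hlp I hI t'
    exact ⟨t'', by rw [reassoc_of% ht'', ht']⟩
  · rintro C ⟨A, B, f, g, w, hA, hB, hs⟩
    obtain ⟨A', hA', E, i, q, wq, hq, hE, hlq⟩ := hA.exists_injStep_right
    have mf : Mono f := hs.mono_f
    let v : B ⟶ E := Injective.factorThru i f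
    have hv : f ≫ v = i := Injective.comp_factorThru i f
    let ψ : ShortComplex.mk f g w ⟶
        ShortComplex.mk (biprod.inl : E ⟶ E ⊞ C) (biprod.snd : E ⊞ C ⟶ C) (by simp) :=
      { τ₁ := i
        τ₂ := biprod.lift v g
        τ₃ := 𝟙 C
        comm₁₂ := by ext <;> simp [hv, w]
        comm₂₃ := by simp }
    have m₁ : Mono ψ.τ₁ := hq.mono_f
    have m₃ : Mono ψ.τ₃ := inferInstanceAs (Mono (𝟙 C))
    have eψ : Mono ψ.τ₂ := ShortComplex.mono_τ₂_of_exact_of_mono ψ hs.exact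
    have c₂ : (ShortComplex.mk ψ.τ₂ (cokernel.π ψ.τ₂) (cokernel.condition _)).ShortExact :=
      { exact := ShortComplex.exact_of_g_is_cokernel _ (cokernelIsCokernel _)
        mono_f := eψ
        epi_g := inferInstanceAs (Epi (cokernel.π ψ.τ₂)) }
    obtain ⟨f', g', w', hs', -, -⟩ :=
      exists_shortExact_of_cokernels ψ hs (shortExact_biprod E C) hq c₂ (shortExact_id_zero C)
    have hEC : IsGorensteinInjective (E ⊞ C) := hB.of_shortExact
      (hA'.of_shortExact (isGorensteinInjective_of_isZero (isZero_zero _)) hs') c₂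
    obtain ⟨P, hP, E', k, r, wr, hr, hE', hlr⟩ := hEC.exists_injStep_right
    have mk : Mono k := hr.mono_f
    have ha : (ShortComplex.mk (biprod.inr : C ⟶ E ⊞ C) (biprod.fst : E ⊞ C ⟶ E)
        (by simp)).ShortExact :=
      { exact := (ShortComplex.Splitting.mk (S := ShortComplex.mk (biprod.inr : C ⟶ E ⊞ C)
          (biprod.fst : E ⊞ C ⟶ E) (by simp)) biprod.snd biprod.inl (by simp) (by simp)
            (by dsimp; rw [add_comm]; exact biprod.total)).exact
        mono_f := inferInstanceAs (Mono biprod.inr)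
        epi_g := inferInstanceAs (Epi biprod.fst) }
    have hc : (ShortComplex.mk ((biprod.inr : C ⟶ E ⊞ C) ≫ k) (cokernel.π _)
        (cokernel.condition _)).ShortExact :=
      { exact := ShortComplex.exact_of_g_is_cokernel _ (cokernelIsCokernel _)
        mono_f := inferInstanceAs (Mono ((biprod.inr : C ⟶ E ⊞ C) ≫ k))
        epi_g := inferInstanceAs (Epi (cokernel.π _)) }
    obtain ⟨x, y, h, hxy, h1, h2⟩ := shortExact_cokernel_comp ha hr hc
    refine ⟨_, of_gi _ (isGorensteinInjective_of_injective.of_shortExact hP hxy),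
      E', _, _, _, hc, hE', fun I hI t ↦ ?_⟩
    obtain ⟨e, he⟩ := hlr I hI (t ≫ y)
    obtain ⟨z, hz⟩ := hxy.exists_lift (t - e ≫ cokernel.π _) (by
      dsimp; rw [Preadditive.sub_comp, Category.assoc, h2, he, sub_self])
    dsimp at hz
    refine ⟨e + z ≫ biprod.inl ≫ k, ?_⟩
    rw [Preadditive.add_comp, Category.assoc, Category.assoc, ← h1, biprod.inl_fst_assoc, hz]
    abel

end CokernelClosure

section SmallSubcomplexes

variable {R : Type u} [Ring R]

lemma injStep_of_linearMap {A E B : Type u} [AddCommGroup A] [Module R A] [AddCommGroup E]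
    [Module R E] [AddCommGroup B] [Module R B] (i : A →ₗ[R] E) (p : E →ₗ[R] B)
    (hi : Function.Injective i) (hp : Function.Surjective p) (h : Function.Exact i p)
    (hE : Module.Injective R E)
    (hl : ∀ (I : Type u) [AddCommGroup I] [Module R I], Module.Injective R I →
      ∀ f : I →ₗ[R] B, ∃ l : I →ₗ[R] E, p ∘ₗ l = f) :
    InjStep (ModuleCat.of R A) (ModuleCat.of R B) := by
  have w : ModuleCat.ofHom i ≫ ModuleCat.ofHom p = 0 := by
    ext x; exact h.apply_apply_eq_zero x
  refine ⟨ModuleCat.of R E, ModuleCat.ofHom i, ModuleCat.ofHom p, w, ?_,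
    Module.injective_object_of_injective_module R E, fun I hI f ↦ ?_⟩
  · exact { exact := (ShortComplex.moduleCat_exact_iff _).2 fun x hx ↦ (h x).1 hx
            mono_f := (ModuleCat.mono_iff_injective _).2 hi
            epi_g := (ModuleCat.epi_iff_surjective _).2 hp }
  · obtain ⟨l, hl'⟩ := hl I (Module.injective_module_of_injective_object R I) f.hom
    exact ⟨ModuleCat.ofHom l, by ext x; exact LinearMap.congr_fun hl' x⟩

variable [IsNoetherianRing R]

lemma isGorensteinInjective_comap {W : Type u}
    (hW : ∀ (I : Type u) [AddCommGroup I] [Module R I], Module.Injective R I →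
      ∀ x : I, ∃ J : Submodule R I, x ∈ J ∧ Module.Injective R J ∧
        ∃ f : W → J, Function.Surjective f)
    (Z E : ℤ → ModuleCat.{u} R) (i : ∀ k, Z (k + 1) →ₗ[R] E k) (p : ∀ k, E k →ₗ[R] Z k)
    (hi : ∀ k, Function.Injective (i k)) (h : ∀ k, Function.Exact (i k) (p k))
    (hE : ∀ k, Module.Injective R (E k)) (T : ∀ k, Submodule R (E k))
    (h₁ : ∀ k, ∀ e ∈ T (k + 1), i k (p (k + 1) e) ∈ T k)
    (h₂ : ∀ k (𝔞 : Ideal R) (φ : 𝔞 → E k), (∀ a, φ a ∈ T k) → baerOp 𝔞 φ ∈ T k)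
    (h₃ : ∀ k, ∀ z : Z (k + 1), i k z ∈ T k → ∃ e ∈ T (k + 1), p (k + 1) e = z)
    (h₄ : ∀ k (N : Submodule R (W →₀ R)), Module.Injective R ((W →₀ R) ⧸ N) →
      ∀ f : ((W →₀ R) ⧸ N) →ₗ[R] Z (k + 1), (∀ x, i k (f x) ∈ T k) →
        ∃ l : ((W →₀ R) ⧸ N) →ₗ[R] E (k + 1), (∀ x, l x ∈ T (k + 1)) ∧ p (k + 1) ∘ₗ l = f) :
    IsGorensteinInjective (ModuleCat.of R ((T 0).comap (i 0))) := by
  let Z' (k : ℤ) : ModuleCat.{u} R := ModuleCat.of R ((T k).comap (i k))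
  refine isGorensteinInjective_of_injSteps Z' (Iso.refl _) ?_
  rintro _ k rfl
  refine injStep_of_linearMap (E := T (k + 1)) ((i (k + 1)).restrict fun x hx ↦ hx)
    ((p (k + 1)).restrict fun x hx ↦ h₁ k x hx) ?_ ?_ ?_ (injective_of_baerOp_mem (hE _) _ (h₂ _))
    ?_
  · intro x y hxy
    exact Subtype.ext (hi _ (congrArg Subtype.val hxy))
  · rintro ⟨z, hz⟩
    obtain ⟨e, he, rfl⟩ := h₃ k z hz
    exact ⟨⟨e, he⟩, rfl⟩
  · rintro ⟨e, he⟩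
    constructor
    · intro hx
      obtain ⟨z, rfl⟩ := (h (k + 1) e).1 (congrArg Subtype.val hx)
      exact ⟨⟨z, he⟩, rfl⟩
    · rintro ⟨z, hz⟩
      refine Subtype.ext ((h (k + 1) e).2 ⟨z.1, congrArg Subtype.val hz⟩)
  · intro I _ _ hI f
    refine exists_lift_of_small hW _ (fun N hN f ↦ ?_) hI f
    obtain ⟨l, hl, hl'⟩ := h₄ k N hN (Submodule.subtype _ ∘ₗ f) fun x ↦ (f x).2
    exact ⟨l.codRestrict _ hl, LinearMap.ext fun x ↦ Subtype.ext (LinearMap.congr_fun hl' x)⟩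

/-- The operations on the totally acyclic complexes of the components of a complex under which
a family of submodules has to be closed. -/
inductive TotalOp (R : Type u) [Ring R] (W : Type u) : Type u
  | diff (n k : ℤ) : TotalOp R W
  | baer (n k : ℤ) (𝔞 : Ideal R) : TotalOp R W
  | preim (n k : ℤ) : TotalOp R W
  | lift (n k : ℤ) (N : Submodule R (W →₀ R)) (x : (W →₀ R) ⧸ N) : TotalOp R W
  | inner (n : ℤ) : TotalOp R W

/-- The sort of the arguments of an operation. -/
def TotalOp.src {W : Type u} : TotalOp R W → ℤ × ℤ
  | .diff n k => (n, k + 1)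
  | .baer n k _ => (n, k)
  | .preim n k => (n, k)
  | .lift n k _ _ => (n, k)
  | .inner n => (n + 1, 0)

/-- The sort of the value of an operation. -/
def TotalOp.tgt {W : Type u} : TotalOp R W → ℤ × ℤ
  | .diff n k => (n, k)
  | .baer n k _ => (n, k)
  | .preim n k => (n, k + 1)
  | .lift n k _ _ => (n, k + 1)
  | .inner n => (n, 0)

/-- The arity of an operation. -/
def TotalOp.arity {W : Type u} : TotalOp R W → Type u
  | .diff _ _ => PUnit
  | .baer _ _ 𝔞 => 𝔞
  | .preim _ _ => PUnit
  | .lift _ _ N _ => (W →₀ R) ⧸ N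
  | .inner _ => PUnit

open Classical in
/-- The action of the operations. -/
noncomputable def TotalOp.act {W : Type u} {G : ℤ → ModuleCat.{u} R}
    (E : ℤ × ℤ → ModuleCat.{u} R)
    (d : ∀ n k, E (n, k + 1) →ₗ[R] E (n, k)) (δ : ∀ n, G (n + 1) →ₗ[R] G n)
    (α : ∀ n, G n →ₗ[R] E (n, 0)) :
    ∀ o : TotalOp R W, (o.arity → E o.src) → E o.tgt
  | .diff n k => fun φ ↦ d n k (φ PUnit.unit)
  | .baer _ _ 𝔞 => fun φ ↦ baerOp 𝔞 φ
  | .preim n k => fun φ ↦ if h : ∃ e, d n k e = φ PUnit.unit then h.choose else 0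
  | .lift n k N x => fun φ ↦ if h : ∃ l : ((W →₀ R) ⧸ N) →ₗ[R] E (n, k + 1), ∀ y, d n k (l y) = φ y
      then h.choose x else 0
  | .inner n => fun φ ↦ if h : ∃ e, α (n + 1) e = φ PUnit.unit then α n (δ n h.choose) else 0

variable (R) in
/-- Every nonzero Gorenstein injective complex has a small nonzero Gorenstein injective subcomplex
with Gorenstein injective cokernel. -/
theorem exists_small_gorensteinInjective_subcomplex :
    ∃ (P : ChainComplex (ModuleCat.{u} R) ℤ), Projective P ∧
      ∀ G : ChainComplex (ModuleCat.{u} R) ℤ, IsGorensteinInjective G → ¬ IsZero G →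
        ∃ (S : ChainComplex (ModuleCat.{u} R) ℤ) (ι : S ⟶ G) (π : P ⟶ S), Mono ι ∧ Epi π ∧
          IsGorensteinInjective S ∧ IsGorensteinInjective (cokernel ι) ∧ ¬ IsZero S := by
  obtain ⟨W₁, hW₁⟩ := exists_small_injective_submodule R
  obtain ⟨W, hW⟩ := exists_small_closed_submodules (R := R) (TotalOp.src (R := R) (W := W₁))
    TotalOp.tgt TotalOp.arity
  have hfree : Projective (ModuleCat.of R (W →₀ R)) :=
    (IsProjective.iff_projective (W →₀ R)).1 inferInstance
  refine ⟨discs fun _ ↦ ModuleCat.of R (W →₀ R), projective_discs fun _ ↦ hfree,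
    fun G hG hG0 ↦ ?_⟩
  have key (n : ℤ) : ∃ Z : ℤ → ModuleCat.{u} R, Nonempty (G.X n ≅ Z (0 + 1)) ∧
      ∀ k, InjStep (Z (k + 1)) (Z k) := by
    obtain ⟨Z, ⟨e⟩, hZ⟩ := (hG.components n).exists_injSteps
    exact ⟨fun k ↦ Z (k - 1), ⟨e ≪≫ eqToIso (by simp)⟩, fun k ↦ hZ _ _ (by omega)⟩
  choose Z e hZ using key
  choose E i p w hse hE hl using hZ
  let d (n k : ℤ) : E n (k + 1) →ₗ[R] E n k := (p n (k + 1) ≫ i n k).hom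
  let α (n : ℤ) : G.X n →ₗ[R] E n 0 := ((e n).some.hom ≫ i n 0).hom
  have hi (n k : ℤ) : Function.Injective (i n k) :=
    (ModuleCat.mono_iff_injective _).1 (hse n k).mono_f
  have hp (n k : ℤ) : Function.Surjective (p n k) :=
    (ModuleCat.epi_iff_surjective _).1 (hse n k).epi_g
  have hex (n k : ℤ) : Function.Exact (i n k) (p n k) :=
    (ShortComplex.ShortExact.moduleCat_exact_iff_function_exact _).1 (hse n k).exact
  have hα (n : ℤ) : Function.Injective (α n) :=
    (hi n 0).comp ((ModuleCat.mono_iff_injective (e n).some.hom).1 inferInstance)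
  obtain ⟨n₀, hn₀⟩ : ∃ n, ¬ IsZero (G.X n) := by
    by_contra! h
    refine hG0 ((IsZero.iff_id_eq_zero _).2 ?_)
    ext n : 1
    exact (h n).eq_of_src _ _
  obtain ⟨x₀, hx₀⟩ : ∃ x : G.X n₀, x ≠ 0 := by
    by_contra! h
    exact hn₀ (@ModuleCat.isZero_of_subsingleton R _ _ ⟨fun x y ↦ by rw [h x, h y]⟩)
  classical
  let x : ∀ n, G.X n := Function.update (fun _ ↦ 0) n₀ x₀
  obtain ⟨T, hgen, hsurj, hT⟩ := hW (fun q ↦ E q.1 q.2)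
    (TotalOp.act (fun q ↦ E q.1 q.2) d (fun n ↦ (G.d (n + 1) n).hom) α)
    (fun q ↦ if h : 0 = q.2 then h ▸ α q.1 (x q.1) else 0)
  have hd (n : ℤ) : ∀ y, α (n + 1) y ∈ T (n + 1, 0) → α n (G.d (n + 1) n y) ∈ T (n, 0) := by
    intro y hy
    have := hT (.inner n) (fun _ ↦ α (n + 1) y) (fun _ ↦ hy)
    have h : ∃ e, α (n + 1) e = α (n + 1) y := ⟨y, rfl⟩
    have h' : TotalOp.act (fun q ↦ E q.1 q.2) d (fun n ↦ (G.d (n + 1) n).hom) α (.inner n : TotalOp R W₁)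
        (fun _ ↦ α (n + 1) y) = α n (G.d (n + 1) n h.choose) := dif_pos h
    rw [h', hα _ h.choose_spec] at this
    exact this
  have hd' (n m : ℤ) : ∀ y ∈ (T (n, 0)).comap (α n), (G.d n m).hom y ∈ (T (m, 0)).comap (α m) := by
    by_cases h : m + 1 = n
    · subst h
      exact hd m
    · intro y _
      rw [G.shape _ _ h]
      exact Submodule.zero_mem _
  have hdiff (n k : ℤ) : ∀ e ∈ T (n, k + 1), i n k (p n (k + 1) e) ∈ T (n, k) :=
    fun e he ↦ hT (.diff n k) (fun _ ↦ e) (fun _ ↦ he)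
  have hbaer (n k : ℤ) (𝔞 : Ideal R) (φ : 𝔞 → E n k) (hφ : ∀ a, φ a ∈ T (n, k)) :
      baerOp 𝔞 φ ∈ T (n, k) := hT (.baer n k 𝔞) φ hφ
  have hpre (n k : ℤ) (z : Z n (k + 1)) (hz : i n k z ∈ T (n, k)) :
      ∃ e ∈ T (n, k + 1), p n (k + 1) e = z := by
    have h : ∃ e, d n k e = i n k z := by
      obtain ⟨e, rfl⟩ := hp n (k + 1) z
      exact ⟨e, rfl⟩
    have hm := hT (.preim n k) (fun _ ↦ i n k z) (fun _ ↦ hz)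
    have h' : TotalOp.act (fun q ↦ E q.1 q.2) d (fun n ↦ (G.d (n + 1) n).hom) α (.preim n k : TotalOp R W₁)
        (fun _ ↦ i n k z) = h.choose := dif_pos h
    rw [h'] at hm
    exact ⟨_, hm, hi n k h.choose_spec⟩
  have hlift (n k : ℤ) (N : Submodule R (W₁ →₀ R)) (hN : Module.Injective R ((W₁ →₀ R) ⧸ N))
      (f : ((W₁ →₀ R) ⧸ N) →ₗ[R] Z n (k + 1)) (hf : ∀ x, i n k (f x) ∈ T (n, k)) :
      ∃ l : ((W₁ →₀ R) ⧸ N) →ₗ[R] E n (k + 1), (∀ x, l x ∈ T (n, k + 1)) ∧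
        (p n (k + 1)).hom ∘ₗ l = f := by
    have h : ∃ l : ((W₁ →₀ R) ⧸ N) →ₗ[R] E n (k + 1), ∀ y, d n k (l y) = i n k (f y) := by
      obtain ⟨l, hl⟩ := hl n (k + 1) _ (Module.injective_object_of_injective_module R _)
        (ModuleCat.ofHom f)
      exact ⟨l.hom, fun y ↦ congrArg (i n k) (LinearMap.congr_fun (congrArg ModuleCat.Hom.hom hl) y)⟩
    refine ⟨h.choose, fun y ↦ ?_, LinearMap.ext fun y ↦ hi n k (h.choose_spec y)⟩
    have hm := hT (.lift n k N y) (fun y ↦ i n k (f y)) hf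
    have h' : TotalOp.act (fun q ↦ E q.1 q.2) d (fun n ↦ (G.d (n + 1) n).hom) α (.lift n k N y)
        (fun y ↦ i n k (f y)) = h.choose y := dif_pos h
    rw [h'] at hm
    exact hm
  let S : ChainComplex (ModuleCat.{u} R) ℤ :=
    { X := fun n ↦ ModuleCat.of R ((T (n, 0)).comap (α n))
      d := fun n m ↦ ModuleCat.ofHom ((G.d n m).hom.restrict (hd' n m))
      shape := fun n m h ↦ by
        ext y
        change (G.d n m).hom y = 0
        rw [G.shape _ _ h]
        rfl
      d_comp_d' := fun n m k _ _ ↦ by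
        ext y
        change (G.d n m ≫ G.d m k).hom y = 0
        rw [G.d_comp_d]
        rfl }
  let ι : S ⟶ G :=
    { f := fun n ↦ ModuleCat.ofHom (Submodule.subtype _)
      comm' := fun n m _ ↦ rfl }
  have hι : Mono ι := by
    have hm (n : ℤ) : Mono (ι.f n) := (ModuleCat.mono_iff_injective _).2 (Submodule.subtype_injective _)
    exact HomologicalComplex.mono_of_mono_f _ hm
  have hS : IsGorensteinInjective S := by
    refine isGorensteinInjective_of_components fun n ↦ ?_
    have hZ := isGorensteinInjective_comap hW₁ (Z n) (E n) (fun k ↦ (i n k).hom)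
      (fun k ↦ (p n k).hom) (hi n) (hex n)
      (fun k ↦ have := hE n k; Module.injective_module_of_injective_object R _)
      (fun k ↦ T (n, k)) (hdiff n) (hbaer n) (hpre n) (hlift n)
    refine hZ.of_iso (LinearEquiv.toModuleIso ?_).symm
    exact (e n).some.toLinearEquiv.submoduleMap _ ≪≫ₗ LinearEquiv.ofEq _ _ (by
      ext y
      constructor
      · rintro ⟨z, hz, rfl⟩
        exact hz
      · intro hy
        exact ⟨(e n).some.inv y, by
          change (i n 0) ((e n).some.hom ((e n).some.inv y)) ∈ T (n, 0)
          rw [Iso.inv_hom_id_apply]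
          exact hy, Iso.inv_hom_id_apply _ _⟩)
  choose q hq using hsurj
  have hsub (n : ℤ) : ∃ f : W → S.X n, Function.Surjective f := by
    refine ⟨fun w ↦ if h : ∃ y : S.X n, α n y.1 = q (n, 0) w then h.choose else 0, fun y ↦ ?_⟩
    obtain ⟨w, hw⟩ := hq (n, 0) ⟨α n y.1, y.2⟩
    have h : ∃ y : S.X n, α n y.1 = q (n, 0) w := ⟨y, by rw [hw]⟩
    refine ⟨w, ?_⟩
    refine (dif_pos h).trans (Subtype.ext (hα n ?_))
    rw [h.choose_spec, hw]
  choose f hf using hsub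
  let π : discs (fun _ ↦ ModuleCat.of R (W →₀ R)) ⟶ S :=
    discsDesc fun n ↦ ModuleCat.ofHom (Finsupp.linearCombination R (f n))
  have hπ : Epi π := by
    have hm (n : ℤ) : Epi (π.f n) := by
      have h : Epi (ModuleCat.ofHom (Finsupp.linearCombination R (f n))) := by
        refine (ModuleCat.epi_iff_surjective _).2 fun y ↦ ?_
        obtain ⟨w, rfl⟩ := hf n y
        exact ⟨Finsupp.single w 1, by simp⟩
      exact epi_of_epi_fac (discsInl_desc _ n)
    exact HomologicalComplex.epi_of_epi_f _ hm
  refine ⟨S, ι, π, hι, hπ, hS, ?_, fun h ↦ ?_⟩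
  · refine hS.cokernel_of_shortExact hG (f := ι) (g := cokernel.π ι) (w := cokernel.condition ι) ?_
    exact { exact := ShortComplex.exact_of_g_is_cokernel _ (cokernelIsCokernel _)
            mono_f := hι
            epi_g := inferInstanceAs (Epi (cokernel.π ι)) }
  · have hx : α n₀ x₀ ∈ T (n₀, 0) := by
      have := hgen (n₀, 0)
      simpa [x] using this
    have h0 : IsZero (S.X n₀) := (HomologicalComplex.eval _ _ n₀).map_isZero h
    have := ModuleCat.subsingleton_of_isZero h0
    exact hx₀ (congrArg Subtype.val (Subsingleton.elim (⟨x₀, hx⟩ : S.X n₀) 0))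

end SmallSubcomplexes

section DirectedClasses

universe v w

variable {𝒜 : Type u} [Category.{v} 𝒜] [Abelian 𝒜]

/-- A class of objects which is closed under isomorphisms, extensions and directed colimits. -/
structure IsDirectedClass (𝒢 : 𝒜 → Prop) : Prop where
  of_iso : ∀ {X Y : 𝒜}, (X ≅ Y) → 𝒢 X → 𝒢 Y
  of_isZero : ∀ {X : 𝒜}, IsZero X → 𝒢 X
  of_shortExact : ∀ {S : ShortComplex 𝒜}, S.ShortExact → 𝒢 S.X₁ → 𝒢 S.X₃ → 𝒢 S.X₂
  of_isColimit : ∀ {J : Type w} [Preorder J] [IsDirectedOrder J] [Nonempty J] {F : J ⥤ 𝒜}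
    {c : Cocone F}, IsColimit c → (∀ j, 𝒢 (F.obj j)) → 𝒢 c.pt

/-- The class of monomorphisms with cokernel in a given class. -/
def inflations (𝒢 : 𝒜 → Prop) : MorphismProperty 𝒜 := fun _ Y f ↦
  ∃ (Z : 𝒜) (g : Y ⟶ Z) (w : f ≫ g = 0), (ShortComplex.mk f g w).ShortExact ∧ 𝒢 Z

lemma inflations_of_mono {𝒢 : 𝒜 → Prop} {X Y : 𝒜} (f : X ⟶ Y) [Mono f] (h : 𝒢 (cokernel f)) :
    inflations 𝒢 f :=
  ⟨_, cokernel.π f, cokernel.condition f,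
    { exact := ShortComplex.exact_of_g_is_cokernel _ (cokernelIsCokernel _)
      mono_f := ‹_›
      epi_g := inferInstanceAs (Epi (cokernel.π f)) }, h⟩

/-- A criterion for short exactness through the universal property of the cokernel. -/
lemma shortExact_of_existsUnique_desc {X Y Z : 𝒜} (f : X ⟶ Y) (g : Y ⟶ Z) (w : f ≫ g = 0)
    (hf : Mono f) (hg : Epi g) (h : ∀ {T : 𝒜} (t : Y ⟶ T), f ≫ t = 0 → ∃ l, g ≫ l = t) :
    (ShortComplex.mk f g w).ShortExact where
  exact := ShortComplex.exact_of_g_is_cokernel _ <|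
    CokernelCofork.IsColimit.ofπ g w (fun t ht ↦ (h t ht).choose) (fun t ht ↦ (h t ht).choose_spec)
      fun t ht m hm ↦ by rw [← cancel_epi g, hm, (h t ht).choose_spec]
  mono_f := hf
  epi_g := hg

lemma CategoryTheory.ShortComplex.ShortExact.exists_desc {S : ShortComplex 𝒜} (hS : S.ShortExact)
    {T : 𝒜} (t : S.X₂ ⟶ T) (ht : S.f ≫ t = 0) : ∃ l, S.g ≫ l = t :=
  have := hS.epi_g
  ⟨hS.exact.desc t ht, hS.exact.g_desc t ht⟩

instance (𝒢 : 𝒜 → Prop) : (inflations 𝒢).IsStableUnderCobaseChange where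
  of_isPushout {A A' B B'} f g f' g' sq hf := by
    obtain ⟨Z, p, w, hs, hZ⟩ := hf
    have hm : Mono f := hs.mono_f
    have hp : Epi p := hs.epi_g
    have hm' : Mono f' := (MorphismProperty.monomorphisms 𝒜).of_isPushout sq hm
    have he : Epi (sq.desc 0 p (by simp [w])) := epi_of_epi_fac (sq.inr_desc _ _ _)
    refine ⟨Z, sq.desc 0 p (by simp [w]), by simp, ?_, hZ⟩
    refine shortExact_of_existsUnique_desc _ _ _ hm' he fun t ht ↦ ?_
    obtain ⟨l, hl⟩ := hs.exists_desc (g' ≫ t) (by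
      dsimp
      rw [← sq.w_assoc, ht, comp_zero])
    dsimp at hl
    exact ⟨l, sq.hom_ext (by simp [ht]) (by simp [hl])⟩

lemma IsDirectedClass.coproduct [HasFilteredColimitsOfSize.{w, w} 𝒜] {𝒢 : 𝒜 → Prop}
    (h𝒢 : IsDirectedClass.{u, v, w} 𝒢)
    {J : Type w} (X : J → 𝒜) [HasCoproduct X] (hX : ∀ j, 𝒢 (X j)) : 𝒢 (∐ X) := by
  classical
  let P : ObjectProperty 𝒜 := 𝒢
  have h₀ : P.IsClosedUnderIsomorphisms := ⟨fun e h ↦ h𝒢.of_iso e h⟩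
  have h₁ : P.ContainsZero := ⟨_, isZero_zero 𝒜, h𝒢.of_isZero (isZero_zero 𝒜)⟩
  have h₂ : P.IsClosedUnderExtensions := ⟨fun h h₁ h₃ ↦ h𝒢.of_shortExact h h₁ h₃⟩
  have h₄ : P.IsClosedUnderBinaryCoproducts := ⟨by
    rintro X ⟨p⟩
    refine h𝒢.of_iso ?_ (h𝒢.of_shortExact (ShortComplex.Splitting.ofHasBinaryBiproduct
      (p.diag.obj ⟨.left⟩) (p.diag.obj ⟨.right⟩)).shortExact (p.prop_diag_obj _)
      (p.prop_diag_obj _))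
    exact biprod.isoCoprod _ _ ≪≫ HasColimit.isoOfNatIso (diagramIsoPair p.diag).symm ≪≫
      (colimit.isColimit _).coconePointUniqueUpToIso p.isColimit⟩
  have h₅ : P.IsClosedUnderFiniteCoproducts := .mk'
  refine h𝒢.of_isColimit (CoproductsFromFiniteFiltered.isColimitFiniteSubproductsCocone X)
    fun s ↦ ?_
  exact P.prop_coproduct fun j ↦ hX _

lemma inflations_coproducts_le [IsGrothendieckAbelian.{w} 𝒜] {𝒢 : 𝒜 → Prop}
    (h𝒢 : IsDirectedClass.{u, v, w} 𝒢) :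
    MorphismProperty.coproducts.{w} (inflations 𝒢) ≤ inflations 𝒢 := by
  have h₀ (J : Type w) : (inflations 𝒢).IsStableUnderCoproductsOfShape J := by
    refine .mk _ _ fun X₁ X₂ _ _ f hf ↦ ?_
    choose Z g w hs hZ using hf
    have hm (j : J) : Mono (f j) := (hs j).mono_f
    have hp (j : J) : Epi (g j) := (hs j).epi_g
    refine ⟨∐ Z, Limits.Sigma.map g, ?_, ?_, h𝒢.coproduct Z hZ⟩
    · ext j
      simp [reassoc_of% w j]
    · refine shortExact_of_existsUnique_desc _ _ _ inferInstance ?_ fun {T} t ht ↦ ?_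
      · refine ⟨fun a b h ↦ ?_⟩
        ext j
        rw [← cancel_epi (g j)]
        simpa using Limits.Sigma.ι X₂ j ≫= h
      · have h (j : J) : ∃ l, g j ≫ l = Limits.Sigma.ι X₂ j ≫ t :=
          (hs j).exists_desc (T := T) _ (by simpa using Limits.Sigma.ι X₁ j ≫= ht)
        choose l hl using h
        exact ⟨Sigma.desc l, by ext j; simp [hl]⟩
  have h₁ : MorphismProperty.IsStableUnderCoproducts.{w} (inflations 𝒢) := {}
  exact MorphismProperty.coproducts_le _

end DirectedClasses

section Precovers

universe v w

variable {𝒜 : Type u} [Category.{v} 𝒜] [Abelian 𝒜] {𝒢 : 𝒜 → Prop}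

lemma IsDirectedClass.of_isWellOrderContinuous (h𝒢 : IsDirectedClass.{u, v, w} 𝒢)
    {J : Type w} [LinearOrder J] [OrderBot J] [SuccOrder J] [WellFoundedLT J]
    (F : J ⥤ 𝒜) [F.IsWellOrderContinuous] (h₀ : 𝒢 (F.obj ⊥))
    (hsucc : ∀ j, ¬ IsMax j → 𝒢 (F.obj j) → 𝒢 (F.obj (Order.succ j))) (j : J) :
    𝒢 (F.obj j) := by
  induction j using SuccOrder.limitRecOn with
  | isMin j hj => rwa [hj.eq_bot]
  | succ j hj h => exact hsucc j hj h
  | isSuccLimit j hj h =>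
    have := hj.nonempty_Iio.to_subtype
    exact h𝒢.of_isColimit (F.isColimitOfIsWellOrderContinuous j hj) fun i ↦ h i.1 i.2

lemma IsDirectedClass.cokernel_of_inflations (h𝒢 : IsDirectedClass.{u, v, w} 𝒢) {X Y : 𝒜}
    {f : X ⟶ Y} (hf : inflations 𝒢 f) : 𝒢 (cokernel f) := by
  obtain ⟨Z, g, w, hs, hZ⟩ := hf
  have hg : Epi g := hs.epi_g
  have h : IsColimit (CokernelCofork.ofπ g w) := hs.exact.gIsCokernel
  exact h𝒢.of_iso (h.coconePointUniqueUpToIso (colimit.isColimit (parallelPair f 0))) hZ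

/-- Lifting against a monomorphism follows from lifting against the kernel of a projective
cover of its cokernel. -/
lemma hasLiftingProperty_of_kernel {A B S P K Q X : 𝒜} [Projective P] {i : A ⟶ B} {g : B ⟶ S}
    {w : i ≫ g = 0} (hs : (ShortComplex.mk i g w).ShortExact) {κ : K ⟶ P} {π : P ⟶ S}
    {w' : κ ≫ π = 0} (hκ : (ShortComplex.mk κ π w').ShortExact) (p : Q ⟶ X)
    [HasLiftingProperty κ p] : HasLiftingProperty i p where
  sq_hasLift {a b} sq := by
    have hi : Mono i := hs.mono_f
    have hg : Epi g := hs.epi_g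
    have hπ : Epi π := hκ.epi_g
    let π' : P ⟶ B := Projective.factorThru π g
    have hπ' : π' ≫ g = π := Projective.factorThru_comp _ _
    obtain ⟨k, hk⟩ := hs.exists_lift (κ ≫ π') (by simp [hπ', w'])
    dsimp at k hk
    have sq' : CommSq (k ≫ a) κ p (π' ≫ b) := ⟨by
      rw [Category.assoc, sq.w, reassoc_of% hk]⟩
    let l : P ⟶ Q := sq'.lift
    have hl : κ ≫ l = k ≫ a := sq'.fac_left
    have hl' : l ≫ p = π' ≫ b := sq'.fac_right
    have he : Epi (biprod.desc i π') := by
      refine Preadditive.epi_of_cancel_zero _ fun {T} t ht ↦ ?_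
      have h₁ : i ≫ t = 0 := by simpa using biprod.inl ≫= ht
      have h₂ : π' ≫ t = 0 := by simpa using biprod.inr ≫= ht
      obtain ⟨m, rfl⟩ := hs.exists_desc t h₁
      dsimp at h₂ ⊢
      rw [← Category.assoc, hπ', ← comp_zero (f := π), cancel_epi] at h₂
      rw [h₂, comp_zero]
    have key {T : 𝒜} (u : T ⟶ A ⊞ P) (h : u ≫ biprod.desc i π' = 0) :
        u ≫ biprod.desc a l = 0 := by
      have hu : (u ≫ biprod.fst) ≫ i + (u ≫ biprod.snd) ≫ π' = 0 := by
        rw [biprod.desc_eq, Preadditive.comp_add] at h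
        simpa using h
      obtain ⟨v, hv⟩ := hκ.exists_lift (u ≫ biprod.snd) (by
        change (u ≫ biprod.snd) ≫ π = 0
        have h' := eq_neg_of_add_eq_zero_right hu =≫ g
        rwa [Category.assoc _ π', hπ', Preadditive.neg_comp, Category.assoc _ i, w, comp_zero,
          neg_zero] at h')
      dsimp at v hv
      have hv' : u ≫ biprod.fst = - v ≫ k := by
        rw [← cancel_mono i, eq_neg_of_add_eq_zero_left hu, ← hv]
        simp [hk]
      rw [biprod.desc_eq, Preadditive.comp_add, ← Category.assoc, hv', ← Category.assoc, ← hv]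
      simp [hl]
    let h := Abelian.epiDesc (biprod.desc i π') (biprod.desc a l) (key _ (kernel.condition _))
    have hh : biprod.desc i π' ≫ h = biprod.desc a l := Abelian.comp_epiDesc _ _ _
    exact ⟨⟨{ l := h
              fac_left := by simpa using biprod.inl ≫= hh
              fac_right := by
                rw [← cancel_epi (biprod.desc i π'), reassoc_of% hh]
                ext
                · simpa using sq.w
                · simpa using hl' }⟩⟩

lemma IsDirectedClass.inflations_of_isColimit [IsGrothendieckAbelian.{w} 𝒜]
    (h𝒢 : IsDirectedClass.{u, v, w} 𝒢) {J : Type w} [Preorder J] [IsDirectedOrder J] [Nonempty J]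
    {G : 𝒜} (F : J ⥤ MonoOver G) (hF : ∀ j, inflations 𝒢 (F.obj j).obj.hom)
    {c : Cocone (F ⋙ MonoOver.forget _ ⋙ Over.forget _)} (hc : IsColimit c) (f : c.pt ⟶ G) [Mono f]
    (hf : ∀ j, c.ι.app j ≫ f = (F.obj j).obj.hom) : inflations 𝒢 f := by
  let π (j : J) : G ⟶ cokernel (F.obj j).obj.hom := cokernel.π _
  have hπ {i j : J} (a : i ⟶ j) : (F.obj i).obj.hom ≫ π j = 0 := by
    rw [← show (F.map a).hom.left ≫ (F.obj j).obj.hom = (F.obj i).obj.hom from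
      MonoOver.w (F.map a), Category.assoc, cokernel.condition, comp_zero]
  let D : J ⥤ 𝒜 :=
    { obj := fun j ↦ cokernel (F.obj j).obj.hom
      map := fun a ↦ cokernel.desc _ (π _) (hπ a) }
  let g (j : J) : G ⟶ colimit D := π j ≫ colimit.ι D j
  have hg' {i j : J} (a : i ⟶ j) : g i = g j := by
    have h : π i ≫ D.map a = π j := cokernel.π_desc _ _ _
    simp only [g, ← h, Category.assoc, colimit.w]
  have hg (i j : J) : g i = g j := by
    obtain ⟨k, hik, hjk⟩ := exists_ge_ge i j
    exact (hg' (homOfLE hik)).trans (hg' (homOfLE hjk)).symm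
  obtain ⟨j₀⟩ := ‹Nonempty J›
  have w : f ≫ g j₀ = 0 := hc.hom_ext fun j ↦ by
    have h : (F.obj j).obj.hom ≫ g j = 0 := by simp [g, π]
    rw [hg j₀ j, ← Category.assoc, hf j]
    exact h.trans comp_zero.symm
  refine ⟨colimit D, g j₀, w, shortExact_of_existsUnique_desc _ _ _ inferInstance ?_ ?_,
    h𝒢.of_isColimit (colimit.isColimit D) fun j ↦ h𝒢.cokernel_of_inflations (hF j)⟩
  · refine ⟨fun a b hab ↦ colimit.hom_ext fun j ↦ ?_⟩
    rw [← cancel_epi (cokernel.π (F.obj j).obj.hom)]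
    rw [hg j₀ j] at hab
    simpa [g, π] using hab
  · intro T t ht
    have h (j : J) : (F.obj j).obj.hom ≫ t = 0 :=
      (hf j =≫ t).symm.trans (by rw [Category.assoc, ht]; exact comp_zero)
    refine ⟨colimit.desc D (Cocone.mk T
      { app := fun j ↦ cokernel.desc _ t (h j)
        naturality := fun i j a ↦ ?_ }), ?_⟩
    · rw [← cancel_epi (cokernel.π (F.obj i).obj.hom)]
      simp [D, π]
    · simp [g, π]

end Precovers

section SmallObjectArgument

universe v w

open MorphismProperty SmallObject IsGrothendieckAbelian ZeroObject

variable {𝒜 : Type u} [Category.{v} 𝒜] [Abelian 𝒜] {𝒢 : 𝒜 → Prop}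

lemma IsDirectedClass.of_transfiniteCompositionOfShape (h𝒢 : IsDirectedClass.{u, v, w} 𝒢)
    {J : Type w} [LinearOrder J] [OrderBot J] [SuccOrder J] [WellFoundedLT J] {X Y : 𝒜} {f : X ⟶ Y}
    (hf : (inflations 𝒢).TransfiniteCompositionOfShape J f) (hX : 𝒢 X) : 𝒢 Y := by
  have := hf.isWellOrderContinuous
  refine h𝒢.of_isColimit hf.isColimit fun j ↦ h𝒢.of_isWellOrderContinuous hf.F
    (h𝒢.of_iso hf.isoBot.symm hX) (fun j hj h ↦ ?_) j
  obtain ⟨Z, g, w, hs, hZ⟩ := hf.map_mem j hj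
  exact h𝒢.of_shortExact hs h hZ

/-- The inclusions of subobjects of an object such that the quotient is in a given class. -/
def inflationsOfSubobject (𝒢 : 𝒜 → Prop) (P : 𝒜) : MorphismProperty 𝒜 :=
  MorphismProperty.ofHoms fun K : {K : Subobject P // 𝒢 (cokernel K.arrow)} ↦ K.1.arrow

lemma inflationsOfSubobject_le (P : 𝒜) : inflationsOfSubobject 𝒢 P ≤ inflations 𝒢 := by
  intro _ _ _ ⟨K⟩
  exact inflations_of_mono _ K.2

instance (P : 𝒜) [IsGrothendieckAbelian.{w} 𝒜] :
    IsSmall.{w} (inflationsOfSubobject 𝒢 P) :=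
  inferInstanceAs (IsSmall.{w} (MorphismProperty.ofHoms _))

instance (P : 𝒜) [IsGrothendieckAbelian.{w} 𝒜] :
    HasSmallObjectArgument.{w} (inflationsOfSubobject 𝒢 P) := by
  obtain ⟨κ, hκ', hκ⟩ := HasCardinalLT.exists_regular_cardinal.{w} (Subobject P)
  have : Fact κ.IsRegular := ⟨hκ'⟩
  have : Nonempty κ.ord.ToType := by simpa using hκ'.ne_zero
  have := WellFoundedLT.toOrderBot κ.ord.ToType
  exact ⟨κ, inferInstance, inferInstance,
    { preservesColimit {A B X Y} i hi f hf := by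
        let hf' : (monomorphisms 𝒜).TransfiniteCompositionOfShape κ.ord.ToType f :=
          { toTransfiniteCompositionOfShape := hf.toTransfiniteCompositionOfShape
            map_mem j hj := by
              have := (hf.attachCells j hj).pushouts_coproducts
              simp only [ofHoms_homFamily] at this
              refine (?_ : _ ≤ monomorphisms 𝒜) _ this
              simp only [pushouts_le_iff, coproducts_le_iff]
              intro _ _ _ ⟨K⟩
              exact inferInstanceAs (Mono K.1.arrow) }
        have (j j' : κ.ord.ToType) (φ : j ⟶ j') : Mono (hf'.F.map φ) := hf'.mem_map φ
        apply preservesColimit_coyoneda_obj_of_mono (Y := hf'.F) (κ := κ)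
        obtain ⟨S⟩ := hi
        exact Subobject.hasCardinalLT_of_mono hκ S.1.arrow }⟩

lemma IsDirectedClass.exists_rlp [IsGrothendieckAbelian.{w} 𝒜]
    (h𝒢 : IsDirectedClass.{u, v, w} 𝒢) (P X : 𝒜) :
    ∃ (Q : 𝒜) (p : Q ⟶ X), 𝒢 Q ∧ (inflationsOfSubobject 𝒢 P).rlp p := by
  obtain ⟨κ, h₁, h₂, h₃⟩ :=
    HasSmallObjectArgument.exists_cardinal (I := inflationsOfSubobject 𝒢 P)
  refine ⟨_, πObj (inflationsOfSubobject 𝒢 P) κ (0 : (0 : 𝒜) ⟶ X), ?_, rlp_πObj _ _ _⟩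
  have hle : (coproducts.{w} (inflationsOfSubobject 𝒢 P)).pushouts ≤ inflations 𝒢 := by
    rw [pushouts_le_iff]
    exact (coproducts_monotone (inflationsOfSubobject_le P)).trans (inflations_coproducts_le h𝒢)
  obtain ⟨h⟩ := transfiniteCompositionsOfShape_ιObj (inflationsOfSubobject 𝒢 P) κ
    (0 : (0 : 𝒜) ⟶ X)
  exact h𝒢.of_transfiniteCompositionOfShape (h.ofLE hle) (h𝒢.of_isZero (isZero_zero _))

end SmallObjectArgument

section PartialLifts

universe v w

variable {𝒜 : Type u} [Category.{v} 𝒜] [Abelian 𝒜]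

/-- A lift of a morphism `ψ` along `p` which is defined on a subobject, such that the quotient is
in a given class. -/
structure PartialLift (𝒢 : 𝒜 → Prop) {G Q X : 𝒜} (ψ : G ⟶ X) (p : Q ⟶ X) where
  dom : Subobject G
  inflations_arrow : inflations 𝒢 dom.arrow
  lift : (dom : 𝒜) ⟶ Q
  lift_comp : lift ≫ p = dom.arrow ≫ ψ

namespace PartialLift

variable {𝒢 : 𝒜 → Prop} {G Q X : 𝒜} {ψ : G ⟶ X} {p : Q ⟶ X}

/-- The relation of being the restriction of a partial lift. -/
def Restricts (a b : PartialLift 𝒢 ψ p) : Prop :=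
  ∃ h : a.dom ≤ b.dom, Subobject.ofLE _ _ h ≫ b.lift = a.lift

lemma Restricts.trans {a b c : PartialLift 𝒢 ψ p} (h : a.Restricts b) (h' : b.Restricts c) :
    a.Restricts c :=
  ⟨h.1.trans h'.1, by rw [← Subobject.ofLE_comp_ofLE _ _ _ h.1 h'.1, Category.assoc, h'.2, h.2]⟩

lemma exists_of_mono {A : 𝒜} (f : A ⟶ G) [Mono f] (hf : inflations 𝒢 f) (l : A ⟶ Q)
    (hl : l ≫ p = f ≫ ψ) : ∃ a : PartialLift 𝒢 ψ p, a.dom = Subobject.mk f ∧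
      ∀ (b : PartialLift 𝒢 ψ p) (k : (b.dom : 𝒜) ⟶ A), k ≫ f = b.dom.arrow → k ≫ l = b.lift →
        b.Restricts a := by
  refine ⟨⟨Subobject.mk f, ?_, (Subobject.underlyingIso f).hom ≫ l, ?_⟩, rfl,
    fun b k hk hk' ↦ ⟨Subobject.le_mk_of_comm k hk, ?_⟩⟩
  · rw [← Subobject.underlyingIso_hom_comp_eq_mk]
    exact MorphismProperty.RespectsIso.precomp _ _ _ hf
  · rw [Category.assoc, hl, Subobject.underlyingIso_hom_comp_eq_mk_assoc]
  · rw [← hk', ← Category.assoc]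
    congr 1
    rw [← cancel_mono f]
    simp [hk]

variable {c : Set (PartialLift 𝒢 ψ p)}

lemma ofLE_comp_lift_of_isChain (hc : IsChain Restricts c) {a b : PartialLift 𝒢 ψ p} (ha : a ∈ c)
    (hb : b ∈ c) (h : a.dom ≤ b.dom) : Subobject.ofLE _ _ h ≫ b.lift = a.lift := by
  by_cases hab : a = b
  · subst hab
    simp
  · obtain ⟨_, h'⟩ | ⟨h', e⟩ := hc ha hb hab
    · exact h'
    · rw [← e, Subobject.ofLE_comp_ofLE_assoc]
      simp

lemma exists_upperBound [IsGrothendieckAbelian.{w} 𝒜] (h𝒢 : IsDirectedClass.{u, v, w} 𝒢)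
    (hc : IsChain Restricts c) (hc' : c.Nonempty) : ∃ b, ∀ a ∈ c, Restricts a b := by
  let T := {A : Subobject G // ∃ a ∈ c, a.dom = A}
  obtain ⟨J, ⟨e⟩⟩ : ∃ J : Type w, Nonempty (J ≃ T) := ⟨_, ⟨(equivShrink.{w} T).symm⟩⟩
  let : Preorder J := Preorder.lift e
  choose x hx hx' using fun j : J ↦ (e j).2
  have : Nonempty J := ⟨e.symm ⟨_, hc'.some, hc'.some_mem, rfl⟩⟩
  have : IsDirectedOrder J := ⟨fun i j ↦ by
    by_cases hij : x i = x j
    · have : e i = e j := Subtype.ext (by rw [← hx', ← hx', hij])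
      exact ⟨i, le_refl _, this.ge⟩
    · obtain h | h := hc (hx i) (hx j) hij
      · have := h.1
        rw [hx', hx'] at this
        exact ⟨j, this, le_refl _⟩
      · have := h.1
        rw [hx', hx'] at this
        exact ⟨i, le_refl _, this⟩⟩
  have mono_dom : Monotone fun j ↦ (x j).dom := fun i j h ↦ by
    dsimp only
    rw [hx', hx']
    exact h
  let F : J ⥤ MonoOver G := mono_dom.functor ⋙ Subobject.representative
  let D := F ⋙ MonoOver.forget _ ⋙ Over.forget _
  have hF {i j : J} (a : i ⟶ j) :
      D.map a = Subobject.ofLE _ _ (mono_dom (leOfHom a)) := rfl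
  let f : colimit D ⟶ G := colimit.desc D (Cocone.mk G
    { app := fun j ↦ (x j).dom.arrow
      naturality := fun i j a ↦ by
        rw [hF]
        exact (Subobject.ofLE_arrow _).trans (Category.comp_id _).symm })
  let l : colimit D ⟶ Q := colimit.desc D (Cocone.mk Q
    { app := fun j ↦ (x j).lift
      naturality := fun i j a ↦ by
        rw [hF]
        exact (ofLE_comp_lift_of_isChain hc (hx i) (hx j) _).trans (Category.comp_id _).symm })
  have hf (j) : colimit.ι D j ≫ f = (x j).dom.arrow := colimit.ι_desc _ _
  have hl (j) : colimit.ι D j ≫ l = (x j).lift := colimit.ι_desc _ _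
  have : Mono f := IsGrothendieckAbelian.mono_of_isColimit_monoOver F (colimit.isColimit D) f hf
  obtain ⟨b, -, hb⟩ := exists_of_mono f
    (h𝒢.inflations_of_isColimit F (fun j ↦ (x j).inflations_arrow) (colimit.isColimit D) f hf) l
    (colimit.hom_ext fun j ↦ by
      rw [← Category.assoc, hl, ← Category.assoc, hf]
      exact (x j).lift_comp)
  refine ⟨b, fun a ha ↦ ?_⟩
  obtain ⟨j, hj⟩ : ∃ j, (x j).dom = a.dom :=
    ⟨e.symm ⟨_, a, ha, rfl⟩, (hx' _).trans (by simp)⟩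
  exact Restricts.trans ⟨hj.ge, ofLE_comp_lift_of_isChain hc ha (hx j) _⟩ (hb _ _ (hf j) (hl j))

end PartialLift

/-- If every nonzero object of a directed class contains a nonzero subobject in the class
which is a quotient of a fixed projective object, with quotient in the class, then every object
has a precover. -/
lemma IsDirectedClass.exists_isPrecover [IsGrothendieckAbelian.{w} 𝒜] {𝒢 : 𝒜 → Prop}
    (h𝒢 : IsDirectedClass.{u, v, w} 𝒢) (P : 𝒜) [Projective P]
    (hP : ∀ G, 𝒢 G → ¬ IsZero G → ∃ (S : 𝒜) (ι : S ⟶ G) (π : P ⟶ S), Mono ι ∧ Epi π ∧ 𝒢 S ∧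
      𝒢 (cokernel ι) ∧ ¬ IsZero S) (X : 𝒜) : ∃ (Q : 𝒜) (p : Q ⟶ X), IsPrecover 𝒢 p := by
  obtain ⟨Q, p, hQ, hp⟩ := h𝒢.exists_rlp P X
  refine ⟨Q, p, hQ, fun G hG ψ ↦ ?_⟩
  have : Nonempty (PartialLift 𝒢 ψ p) := by
    obtain ⟨a, -⟩ := PartialLift.exists_of_mono (ψ := ψ) (p := p) (0 : (⊥_ 𝒜) ⟶ G)
      (inflations_of_mono _ (h𝒢.of_iso cokernelZeroIsoTarget.symm hG)) 0 (by simp)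
    exact ⟨a⟩
  obtain ⟨m, hm⟩ := exists_maximal_of_nonempty_chains_bounded
    (fun (c : Set (PartialLift 𝒢 ψ p)) hc hc' ↦ PartialLift.exists_upperBound h𝒢 hc hc')
    PartialLift.Restricts.trans
  let q : G ⟶ cokernel m.dom.arrow := cokernel.π _
  by_cases h0 : IsZero (cokernel m.dom.arrow)
  · have : Epi m.dom.arrow := Preadditive.epi_of_isZero_cokernel _ h0
    have : IsIso m.dom.arrow := isIso_of_mono_of_epi _
    exact ⟨inv m.dom.arrow ≫ m.lift, by simp [m.lift_comp]⟩
  · exfalso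
    obtain ⟨S, ι, π, mι, eπ, hS, hι, hS0⟩ :=
      hP _ (h𝒢.cokernel_of_inflations m.inflations_arrow) h0
    have hS₁ : (ShortComplex.mk m.dom.arrow q (cokernel.condition _)).ShortExact :=
      { exact := ShortComplex.exact_of_g_is_cokernel _ (cokernelIsCokernel _)
        mono_f := inferInstanceAs (Mono m.dom.arrow)
        epi_g := inferInstanceAs (Epi (cokernel.π _)) }
    have hS₂ : (ShortComplex.mk ι (cokernel.π ι) (cokernel.condition _)).ShortExact :=
      { exact := ShortComplex.exact_of_g_is_cokernel _ (cokernelIsCokernel _)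
        mono_f := mι
        epi_g := inferInstanceAs (Epi (cokernel.π _)) }
    have hq : Epi (q ≫ cokernel.π ι) := epi_comp _ _
    have hS₃ : (ShortComplex.mk (kernel.ι (q ≫ cokernel.π ι)) (q ≫ cokernel.π ι)
        (kernel.condition _)).ShortExact :=
      { exact := ShortComplex.exact_of_f_is_kernel _ (kernelIsKernel _)
        mono_f := inferInstanceAs (Mono (kernel.ι _))
        epi_g := hq }
    obtain ⟨x, y, w, hxy, hx⟩ := shortExact_kernel_comp hS₁ hS₂ hS₃
    have hS₄ : (ShortComplex.mk (kernelSubobject π).arrow π (by simp)).ShortExact :=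
      { exact := ShortComplex.exact_of_f_is_kernel _ <|
          KernelFork.IsLimit.ofι' _ _ fun t ht ↦ ⟨factorThruKernelSubobject π t ht, by simp⟩
        mono_f := inferInstanceAs (Mono (kernelSubobject π).arrow)
        epi_g := eπ }
    have hK : 𝒢 (cokernel (kernelSubobject π).arrow) := h𝒢.cokernel_of_inflations ⟨_, _, _, hS₄, hS⟩
    have := hp _ (MorphismProperty.ofHoms.mk
      (⟨kernelSubobject π, hK⟩ : {K : Subobject P // 𝒢 (cokernel K.arrow)}))
    have := hasLiftingProperty_of_kernel hxy hS₄ p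
    have sq : CommSq m.lift x p (kernel.ι (q ≫ cokernel.π ι) ≫ ψ) :=
      ⟨by rw [m.lift_comp, reassoc_of% hx]⟩
    obtain ⟨a, ha, ha'⟩ := PartialLift.exists_of_mono (kernel.ι (q ≫ cokernel.π ι))
      ⟨_, _, _, hS₃, hι⟩ sq.lift sq.fac_right
    have hle := (hm a (ha' m x hx sq.fac_left)).1
    rw [ha] at hle
    have hk := Subobject.ofMkLE_arrow hle
    have hx' : Subobject.ofMkLE _ _ hle ≫ x = 𝟙 _ := by
      rw [← cancel_mono (kernel.ι (q ≫ cokernel.π ι)), Category.assoc, hx, hk, Category.id_comp]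
    have hy : Epi y := hxy.epi_g
    have hy0 : y = 0 := by
      rw [← Category.id_comp y, ← hx', Category.assoc, w, comp_zero]
    exact hS0 (IsZero.of_epi_eq_zero y hy0)

end PartialLifts

lemma isDirectedClass_isGorensteinInjective (R : Type u) [Ring R] [IsNoetherianRing R]
    (hlim : ∀ (ι : Type u) [Preorder ι] [IsDirected ι (· ≤ ·)] [Nonempty ι]
      (F : ι ⥤ ModuleCat.{u} R), (∀ i, IsGorensteinInjective (F.obj i)) →
        IsGorensteinInjective (colimit F)) :
    IsDirectedClass.{u + 1, u, u}
      (fun K : ChainComplex (ModuleCat.{u} R) ℤ ↦ IsGorensteinInjective K) where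
  of_iso e h := h.of_iso e
  of_isZero h := isGorensteinInjective_of_isZero h
  of_shortExact hS h₁ h₃ := h₁.of_shortExact h₃ hS
  of_isColimit {J _ _ _ F c} hc h := by
    refine isGorensteinInjective_of_components fun n ↦ ?_
    let E := HomologicalComplex.eval (ModuleCat.{u} R) (ComplexShape.down ℤ) n
    have hE : IsColimit (E.mapCocone c) := isColimitOfPreserves E hc
    exact (hlim J (F ⋙ E) fun j ↦ (h j).components n).of_iso
      ((colimit.isColimit _).coconePointUniqueUpToIso hE)

lemma exists_isPrecover_isGorensteinInjective (R : Type u) [Ring R] [IsNoetherianRing R]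
    (hlim : ∀ (ι : Type u) [Preorder ι] [IsDirected ι (· ≤ ·)] [Nonempty ι]
      (F : ι ⥤ ModuleCat.{u} R), (∀ i, IsGorensteinInjective (F.obj i)) →
        IsGorensteinInjective (colimit F)) (X : ChainComplex (ModuleCat.{u} R) ℤ) :
    ∃ (Q : ChainComplex (ModuleCat.{u} R) ℤ) (p : Q ⟶ X),
      IsPrecover (fun K ↦ IsGorensteinInjective K) p := by
  obtain ⟨P, hP, h⟩ := exists_small_gorensteinInjective_subcomplex R
  exact (isDirectedClass_isGorensteinInjective R hlim).exists_isPrecover P h X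

section Chains

universe v w

variable {𝒜 : Type u} [Category.{v} 𝒜] [Abelian 𝒜] {𝒢 : 𝒜 → Prop}

lemma IsDirectedClass.exists_chain [HasColimitsOfSize.{w, w} 𝒜]
    (h𝒢 : IsDirectedClass.{u, v, w} 𝒢) (J : Type w) [LinearOrder J] [OrderBot J] [SuccOrder J]
    [WellFoundedLT J] [NoMaxOrder J] {X : 𝒜} (P : Over X) (hP : 𝒢 P.left)
    (W : MorphismProperty (Over X))
    (hW : ∀ V : Over X, 𝒢 V.left → (P ⟶ V) → ∃ (V' : Over X) (f : V ⟶ V'), 𝒢 V'.left ∧ W f) :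
    ∃ F : J ⥤ Over X, F.IsWellOrderContinuous ∧ (∀ j, 𝒢 (F.obj j).left) ∧
      ∀ j, W (F.map (homOfLE (Order.le_succ j))) := by
  have : HasIterationOfShape J (Over X) := { }
  have hW' (V : Over X) : ∃ (V' : Over X) (f : V ⟶ V'),
      𝒢 V.left → (P ⟶ V) → 𝒢 V'.left ∧ W f := by
    by_cases h : 𝒢 V.left ∧ Nonempty (P ⟶ V)
    · obtain ⟨V', f, hf⟩ := hW V h.1 h.2.some
      exact ⟨V', f, fun _ _ ↦ hf⟩
    · exact ⟨V, 𝟙 V, fun h₁ h₂ ↦ (h ⟨h₁, ⟨h₂⟩⟩).elim⟩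
  choose succ toSucc hs using hW'
  let Φ : SmallObject.SuccStruct (Over X) := { X₀ := P, succ := succ, toSucc := toSucc }
  let F := Φ.iterationFunctor J
  have hP' (j : J) : Nonempty (P ⟶ F.obj j) := ⟨(Φ.ιIterationFunctor J).app j⟩
  have hle : Φ.prop ≤ fun V V' f ↦ 𝒢 V.left → (P ⟶ V) → 𝒢 V'.left ∧ W f := by
    intro _ _ _ ⟨V⟩
    exact hs V
  have hsucc (j : J) := hle _ (Φ.prop_iterationFunctor_map_succ j (not_isMax j))
  have hF (j : J) : 𝒢 (F.obj j).left := by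
    induction j using SuccOrder.limitRecOn with
    | isMin j hj =>
      rw [hj.eq_bot]
      exact h𝒢.of_iso ((Over.forget X).mapIso (Φ.iterationFunctorObjBotIso J)).symm hP
    | succ j hj h => exact (hsucc j h (hP' j).some).1
    | isSuccLimit j hj h =>
      have := hj.nonempty_Iio.to_subtype
      exact h𝒢.of_isColimit (isColimitOfPreserves (Over.forget X)
        (F.isColimitOfIsWellOrderContinuous j hj)) fun i ↦ h i.1 i.2
  exact ⟨F, inferInstance, hF, fun j ↦ (hsucc j (hF j) (hP' j).some).2⟩

end Chains

section Covers

variable {R : Type u} [Ring R] {𝒢 : ChainComplex (ModuleCat.{u} R) ℤ → Prop}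
  {X : ChainComplex (ModuleCat.{u} R) ℤ}

lemma exists_rep_of_isSuccLimit {J : Type u} [LinearOrder J] [OrderBot J] [SuccOrder J]
    [WellFoundedLT J] (F : J ⥤ Over X) [F.IsWellOrderContinuous] (j : J) (hj : Order.IsSuccLimit j)
    {n : ℤ} (x : (F.obj j).left.X n) :
    ∃ (i : J) (hij : i < j) (y : (F.obj i).left.X n), (F.map (homOfLE hij.le)).left.f n y = x := by
  have := hj.nonempty_Iio.to_subtype
  obtain ⟨i, y, hy⟩ := Concrete.isColimit_exists_rep _ (isColimitOfPreserves
    (Over.forget X ⋙ HomologicalComplex.eval (ModuleCat.{u} R) (ComplexShape.down ℤ) n)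
    (F.isColimitOfIsWellOrderContinuous j hj)) x
  exact ⟨i.1, i.2, y, hy⟩

lemma mono_of_forall_apply_eq_zero {K L : ChainComplex (ModuleCat.{u} R) ℤ} (f : K ⟶ L)
    (h : ∀ n (x : K.X n), f.f n x = 0 → x = 0) : Mono f :=
  have (n : ℤ) : Mono (f.f n) := by
    rw [ModuleCat.mono_iff_injective, injective_iff_map_eq_zero]
    exact h n
  HomologicalComplex.mono_of_mono_f f this

/-- If every object has a precover, then there is a weakly terminal object over a given object
such that every morphism out of it is a monomorphism. -/
lemma IsDirectedClass.exists_forall_mono (h𝒢 : IsDirectedClass.{u + 1, u, u} 𝒢)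
    {Q : ChainComplex (ModuleCat.{u} R) ℤ} {p : Q ⟶ X} (hp : IsPrecover 𝒢 p) :
    ∃ (T : ChainComplex (ModuleCat.{u} R) ℤ) (t : T ⟶ X), IsPrecover 𝒢 t ∧
      ∀ (V : Over X), 𝒢 V.left → ∀ f : Over.mk t ⟶ V, Mono f.left := by
  by_contra! H
  obtain ⟨κ, hκ, hκ'⟩ := HasCardinalLT.exists_regular_cardinal.{u} (ℕ ⊕ Σ n, Q.X n)
  have hQκ : HasCardinalLT (Σ n, Q.X n) κ := hκ'.of_injective _ Sum.inr_injective
  have hℕκ : HasCardinalLT ℕ κ := hκ'.of_injective _ Sum.inl_injective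
  have : Fact κ.IsRegular := ⟨hκ⟩
  have : Nonempty κ.ord.ToType := by simpa using hκ.ne_zero
  have := WellFoundedLT.toOrderBot κ.ord.ToType
  have := Cardinal.noMaxOrder hκ.aleph0_le
  have hQ (V : Over X) (hV : 𝒢 V.left) : Nonempty (V ⟶ Over.mk p) := by
    obtain ⟨h, hh⟩ := hp.2 _ hV V.hom
    exact ⟨Over.homMk h hh⟩
  obtain ⟨F, hF, hF𝒢, hFW⟩ := h𝒢.exists_chain κ.ord.ToType (Over.mk p) hp.1
    (fun _ V' f ↦ HasCardinalLT (Σ n, V'.left.X n) κ ∧ ¬ Mono f.left) fun V hV g ↦ by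
      obtain ⟨V', hV', f, hf⟩ := H V.left V.hom ⟨hV, fun G hG ψ ↦ by
        obtain ⟨h, hh⟩ := hp.2 G hG ψ
        exact ⟨h ≫ g.left, by rw [Category.assoc, Over.w g]; exact hh⟩⟩
      obtain ⟨k⟩ := hQ V' hV'
      refine ⟨_, (show V ⟶ V' from f) ≫ k, hp.1, hQκ, fun h ↦ hf ?_⟩
      rw [Over.comp_left] at h
      exact mono_of_mono _ k.left
  have hmap {i j k : κ.ord.ToType} (hij : i ≤ j) (hjk : j ≤ k) {n : ℤ} (x : (F.obj i).left.X n) :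
      (F.map (homOfLE (hij.trans hjk))).left.f n x =
        (F.map (homOfLE hjk)).left.f n ((F.map (homOfLE hij)).left.f n x) := by
    rw [← homOfLE_comp hij hjk, F.map_comp]
    rfl
  have hb (i : κ.ord.ToType) : ∃ (j : κ.ord.ToType) (hj : Order.succ i ≤ j),
      ∀ (n : ℤ) (x : (F.obj (Order.succ i)).left.X n) (k : κ.ord.ToType) (hk : Order.succ i ≤ k),
        (F.map (homOfLE hk)).left.f n x = 0 → (F.map (homOfLE hj)).left.f n x = 0 := by
    have (x : Σ n, (F.obj (Order.succ i)).left.X n) : ∃ (j : κ.ord.ToType) (hj : Order.succ i ≤ j),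
        ∀ (k : κ.ord.ToType) (hk : Order.succ i ≤ k),
          (F.map (homOfLE hk)).left.f x.1 x.2 = 0 → (F.map (homOfLE hj)).left.f x.1 x.2 = 0 := by
      by_cases h : ∃ (k : κ.ord.ToType) (hk : Order.succ i ≤ k),
          (F.map (homOfLE hk)).left.f x.1 x.2 = 0
      · obtain ⟨k, hk, h⟩ := h
        exact ⟨k, hk, fun _ _ _ ↦ h⟩
      · push Not at h
        exact ⟨_, le_rfl, fun k hk hk' ↦ (h k hk hk').elim⟩
    choose b hb hb' using this
    let m := IsCardinalFiltered.max b (hFW i).1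
    have hm (x) : b x ≤ m := leOfHom (IsCardinalFiltered.toMax b (hFW i).1 x)
    refine ⟨max m (Order.succ i), le_max_right _ _, fun n x k hk hx ↦ ?_⟩
    rw [hmap (hb ⟨n, x⟩) ((hm _).trans (le_max_left _ _)), hb' ⟨n, x⟩ k hk hx, map_zero]
  choose b hb hb' using hb
  let a (n : ℕ) : κ.ord.ToType := b^[n] ⊥
  have ha (n : ℕ) : a (n + 1) = b (a n) := Function.iterate_succ_apply' _ _ _
  have hlt (n : ℕ) : a n < a (n + 1) := by
    rw [ha]
    exact (Order.lt_succ _).trans_le (hb _)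
  have hbdd : BddAbove (Set.range a) :=
    ⟨IsCardinalFiltered.max a hℕκ, by
      rintro _ ⟨n, rfl⟩
      exact leOfHom (IsCardinalFiltered.toMax a hℕκ n)⟩
  obtain ⟨l, hl⟩ : ∃ l, IsLUB (Set.range a) l :=
    ⟨WellFounded.min wellFounded_lt _ hbdd, WellFounded.min_mem _ _ _,
      fun k hk ↦ WellFounded.min_le _ hk⟩
  have hal (n : ℕ) : a n < l := (hlt n).trans_le (hl.1 ⟨_, rfl⟩)
  have hl' {i : κ.ord.ToType} (hi : i < l) : ∃ n, i < a n := by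
    obtain ⟨_, ⟨n, rfl⟩, hn, -⟩ := hl.exists_between hi
    exact ⟨n, hn⟩
  have hlim : Order.IsSuccLimit l :=
    ⟨fun h ↦ (h (hal 0).le).not_gt (hal 0), fun i hi ↦ by
      obtain ⟨n, hn⟩ := hl' hi.1
      exact hi.2 hn (hal n)⟩
  refine (hFW l).2 (mono_of_forall_apply_eq_zero _ fun n x hx ↦ ?_)
  obtain ⟨i, hi, y, rfl⟩ := exists_rep_of_isSuccLimit F l hlim x
  obtain ⟨m, hm⟩ := hl' hi
  have hi' : i ≤ Order.succ (a m) := hm.le.trans (Order.le_succ _)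
  have hml : b (a m) ≤ l := by
    rw [← ha]
    exact (hal _).le
  have hml' : Order.succ (a m) ≤ l := (hb _).trans hml
  rw [hmap hi' hml'] at hx ⊢
  rw [← hmap hml' (Order.le_succ l)] at hx
  rw [hmap (hb _) hml, hb' _ _ _ _ _ hx, map_zero]

lemma IsDirectedClass.exists_isCover (h𝒢 : IsDirectedClass.{u + 1, u, u} 𝒢)
    {Q : ChainComplex (ModuleCat.{u} R) ℤ} {p : Q ⟶ X} (hp : IsPrecover 𝒢 p) :
    ∃ (T : ChainComplex (ModuleCat.{u} R) ℤ) (t : T ⟶ X), IsCover 𝒢 t := by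
  obtain ⟨T, t, ht, hmono⟩ := h𝒢.exists_forall_mono hp
  refine ⟨T, t, ht, fun g hg ↦ ?_⟩
  have hgm : Mono g := hmono (Over.mk t) ht.1 (Over.homMk g hg)
  by_contra hiso
  have hepi : ¬ Epi g := fun _ ↦ hiso (isIso_of_mono_of_epi g)
  obtain ⟨κ, hκ, hκ'⟩ := HasCardinalLT.exists_regular_cardinal.{u} (Σ n, T.X n)
  have : Fact κ.IsRegular := ⟨hκ⟩
  have : Nonempty κ.ord.ToType := by simpa using hκ.ne_zero
  have := WellFoundedLT.toOrderBot κ.ord.ToType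
  have := Cardinal.noMaxOrder hκ.aleph0_le
  obtain ⟨F, hF, hF𝒢, hFW⟩ := h𝒢.exists_chain κ.ord.ToType (Over.mk t) ht.1
    (fun _ V' f ↦ ¬ Epi f.left ∧ ∀ (V : Over X), 𝒢 V.left → ∀ g : V' ⟶ V, Mono g.left)
    fun V hV _ ↦ by
      obtain ⟨h, hh⟩ := ht.2 _ hV V.hom
      refine ⟨Over.mk t, (Over.homMk h hh : V ⟶ Over.mk t) ≫
        (Over.homMk g hg : Over.mk t ⟶ Over.mk t), ht.1,
        fun he ↦ hepi ?_, hmono⟩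
      rw [Over.comp_left] at he
      have he : Epi (h ≫ g) := he
      exact epi_of_epi h g
  have hc : 𝒢 (colimit F).left :=
    h𝒢.of_isColimit (isColimitOfPreserves (Over.forget X) (colimit.isColimit F)) hF𝒢
  obtain ⟨h, hh⟩ := ht.2 _ hc (colimit F).hom
  let q (j : κ.ord.ToType) : F.obj j ⟶ Over.mk t := colimit.ι F j ≫ Over.homMk h hh
  have hq {i j : κ.ord.ToType} (hij : i ≤ j) (n : ℤ) (x : (F.obj i).left.X n) :
      (q j).left.f n ((F.map (homOfLE hij)).left.f n x) = (q i).left.f n x := by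
    have : F.map (homOfLE hij) ≫ q j = q i := colimit.w_assoc _ _ _
    rw [← this]
    rfl
  have hqs (j : κ.ord.ToType) (n : ℤ) : Function.Injective ((q (Order.succ j)).left.f n) := by
    have : Mono (q (Order.succ j)).left := (hFW j).2 _ ht.1 _
    rw [← ModuleCat.mono_iff_injective]
    infer_instance
  have hne (j : κ.ord.ToType) : ∃ (n : ℤ) (y : (F.obj (Order.succ (Order.succ j))).left.X n),
      ∀ x, (F.map (homOfLE (Order.le_succ (Order.succ j)))).left.f n x ≠ y := by
    by_contra! H
    refine (hFW (Order.succ j)).1 (HomologicalComplex.epi_of_epi_f _ fun n ↦ ?_)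
    rw [ModuleCat.epi_iff_surjective]
    exact H n
  choose n y hy using hne
  let e (j : κ.ord.ToType) : Σ n, T.X n := ⟨n j, (q (Order.succ (Order.succ j))).left.f _ (y j)⟩
  have he {i j : κ.ord.ToType} (hij : i < j) : e i ≠ e j := by
    intro h
    have hij' : Order.succ (Order.succ i) ≤ Order.succ j :=
      Order.succ_le_succ (Order.succ_le_of_lt hij)
    have key : ∃ z : (F.obj (Order.succ j)).left.X (e i).1, (q (Order.succ j)).left.f _ z = (e i).2 :=
      ⟨_, hq hij' _ _⟩
    rw [h] at key
    obtain ⟨z, hz⟩ := key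
    refine hy j z (hqs (Order.succ j) _ ?_)
    rw [hq]
    exact hz
  have hinj : Function.Injective e := fun i j hij ↦ by
    obtain h | h | h := lt_trichotomy i j
    · exact (he h hij).elim
    · exact h
    · exact (he h hij.symm).elim
  have := hκ'.of_injective _ hinj
  rw [hasCardinalLT_iff_cardinal_mk_lt] at this
  simp at this

end Covers

/-- Let `R` be a two-sided noetherian ring.  If the class of Gorenstein
injective left `R`-modules is closed under direct limits, then the class of Gorenstein
injective complexes is covering in `Ch(R)`. -/
theorem gorensteinInjective_complexes_covering_of_closed_under_direct_limits
    (R : Type u) [Ring R] [IsNoetherianRing R] [IsNoetherianRing Rᵐᵒᵖ]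
    (hlim : ∀ (ι : Type u) [Preorder ι] [IsDirected ι (· ≤ ·)] [Nonempty ι]
      (F : ι ⥤ ModuleCat.{u} R), (∀ i, IsGorensteinInjective (F.obj i)) →
        IsGorensteinInjective (colimit F)) :
    ∀ X : ChainComplex (ModuleCat.{u} R) ℤ,
      ∃ (G : ChainComplex (ModuleCat.{u} R) ℤ) (φ : G ⟶ X),
        IsCover (fun K => IsGorensteinInjective K) φ := by
  intro X
  obtain ⟨Q, p, hp⟩ := exists_isPrecover_isGorensteinInjective R hlim X
  exact (isDirectedClass_isGorensteinInjective R hlim).exists_isCover hp
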